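/- Let E be an m-dimensional extremal subset of an Alexandrov space M. Then the m-dimensional Hausdorff measure of E computed with the intrinsic metric d_E equals the m-dimensional Hausdorff measure computed with the extrinsic metric d. -/

import Mathlib

open Real Metric Set
open scoped ENNReal NNReal

noncomputable section

/-- The comparison angle in the `κ`-plane at the vertex between sides of
lengths `s` and `t`, opposite side of length `d`. -/
def cangleK (κ s t d : ℝ) : ℝ :=
  if 0 < κ then
    Real.arccos ((Real.cos (Real.sqrt κ * d) - Real.cos (Real.sqrt κ * s) * Real.cos (Real.sqrt κ * t)) /
      (Real.sin (Real.sqrt κ * s) * Real.sin (Real.sqrt κ * t)))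
  else if κ < 0 then
    Real.arccos ((Real.cosh (Real.sqrt (-κ) * s) * Real.cosh (Real.sqrt (-κ) * t) -
      Real.cosh (Real.sqrt (-κ) * d)) /
      (Real.sinh (Real.sqrt (-κ) * s) * Real.sinh (Real.sqrt (-κ) * t)))
  else Real.arccos ((s ^ 2 + t ^ 2 - d ^ 2) / (2 * s * t))

/-- The comparison angle `∠̃ q p r` at `p` in the `κ`-plane. -/
def cangle {X : Type*} [MetricSpace X] (κ : ℝ) (q p r : X) : ℝ :=
  cangleK κ (dist p q) (dist p r) (dist q r)

/-- A `(k,δ)`-strainer at `p` (comparison angles taken in the `κ`-plane). -/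
def IsStrainer {X : Type*} [MetricSpace X] (κ : ℝ) {k : ℕ} (a b : Fin k → X) (p : X)
    (δ : ℝ) : Prop :=
  (∀ i, π - δ < cangle κ (a i) p (b i)) ∧
  ∀ i j, i ≠ j →
    π / 2 - δ < cangle κ (a i) p (a j) ∧
    π / 2 - δ < cangle κ (a i) p (b j) ∧
    π / 2 - δ < cangle κ (b i) p (b j)

/-- A `(k,δ)`-strained point. -/
def IsStrainedPt {X : Type*} [MetricSpace X] (κ : ℝ) (k : ℕ) (δ : ℝ) (p : X) : Prop :=
  ∃ a b : Fin k → X, IsStrainer κ a b p δ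

/-- An Alexandrov space of curvature `≥ κ`: complete, geodesic (via midpoints), and the
sum of the three `κ`-comparison angles of any quadruple is at most `2π`. -/
def IsAlexandrov (X : Type*) [MetricSpace X] (κ : ℝ) : Prop :=
  CompleteSpace X ∧
  (∀ x y : X, ∃ z : X, dist x z = dist x y / 2 ∧ dist z y = dist x y / 2) ∧
  ∀ p q r s : X, q ≠ p → r ≠ p → s ≠ p →
    cangle κ q p r + cangle κ r p s + cangle κ s p q ≤ 2 * π

/-- `p` is a critical point of `dist q`. -/
def IsCriticalPt {X : Type*} [MetricSpace X] (κ : ℝ) (q p : X) : Prop :=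
  ∀ x : X, x ≠ p → cangle κ q p x ≤ π / 2

/-- An extremal subset: closed, and every local minimum point `p ∈ E` of `dist q|_E`
with `q ∉ E` is a critical point of `dist q`. -/
def IsExtremal {X : Type*} [MetricSpace X] (κ : ℝ) (E : Set X) : Prop :=
  IsClosed E ∧
  ∀ q ∉ E, ∀ p ∈ E, IsLocalMinOn (fun x => dist q x) E p → IsCriticalPt κ q p

/-- A primitive extremal subset: an extremal subset containing no proper extremal
subset with nonempty relative interior. -/
def IsPrimitiveExtremal {X : Type*} [MetricSpace X] (κ : ℝ) (E : Set X) : Prop :=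
  IsExtremal κ E ∧
  ∀ F : Set X, IsExtremal κ F → F ⊆ E → F ≠ E →
    ∀ x ∈ F, ¬ ∃ r > (0:ℝ), Metric.ball x r ∩ E ⊆ F

/-- `p` is a regular point of `E` of dimension `m`: the tangent cone of `E` at `p`
(with the extrinsic metric) is isometric to `ℝ^m`, expressed through blow-ups:
balls of `E` around `p` at scale `r` are `εr`-approximated by `r`-balls of `ℝ^m`. -/
def IsRegularPt {X : Type*} [MetricSpace X] (E : Set X) (m : ℕ) (p : X) : Prop :=
  ∀ ε > (0:ℝ), ∃ r₀ > (0:ℝ), ∀ r, 0 < r → r < r₀ →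
    ∃ f : X → EuclideanSpace ℝ (Fin m),
      f p = 0 ∧
      (∀ x ∈ E ∩ Metric.closedBall p r, ∀ y ∈ E ∩ Metric.closedBall p r,
        |dist (f x) (f y) - dist x y| ≤ ε * r) ∧
      (∀ v ∈ Metric.closedBall (0 : EuclideanSpace ℝ (Fin m)) r,
        ∃ x ∈ E ∩ Metric.closedBall p r, dist (f x) v ≤ ε * r)

/-- The intrinsic (induced length) extended distance on a subset `E`. -/
def intrinsicEDist {X : Type*} [MetricSpace X] (E : Set X) (x y : X) : ℝ≥0∞ :=
  ⨅ (γ : ℝ → X) (_ : ContinuousOn γ (Set.Icc 0 1)) (_ : γ 0 = x) (_ : γ 1 = y)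
    (_ : ∀ t ∈ Set.Icc (0:ℝ) 1, γ t ∈ E), eVariationOn γ (Set.Icc 0 1)

/-- Diameter of a set with respect to an abstract extended distance. -/
def ediamOn {X : Type*} (ρ : X → X → ℝ≥0∞) (s : Set X) : ℝ≥0∞ :=
  ⨆ x ∈ s, ⨆ y ∈ s, ρ x y

/-- The `m`-dimensional Hausdorff measure of `S` with respect to an abstract
extended distance `ρ`. -/
def hMeas {X : Type*} (ρ : X → X → ℝ≥0∞) (m : ℝ) (S : Set X) : ℝ≥0∞ :=
  ⨆ (ε : ℝ≥0∞) (_ : 0 < ε),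
    ⨅ (t : ℕ → Set X) (_ : S ⊆ ⋃ n, t n) (_ : ∀ n, ediamOn ρ (t n) ≤ ε),
      ∑' n, ediamOn ρ (t n) ^ m

end

/-! ### Comparison of the model cosine with the Euclidean cosine -/

/-- Error of linear interpolation for a function with Lipschitz derivative. -/
theorem abs_sub_interpolation_le {f g : ℝ → ℝ} {a b L c : ℝ} (hab : a ≤ b)
    (hf : ContinuousOn f (Icc a b)) (hfg : ∀ u ∈ Ioo a b, HasDerivAt f (g u) u)
    (hg : ∀ u ∈ Ioo a b, ∀ v ∈ Ioo a b, |g u - g v| ≤ L * |u - v|)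
    (hc : -1 ≤ c) (hc' : c ≤ 1) :
    |f ((a + b) / 2 - (b - a) / 2 * c) - ((1 + c) / 2 * f a + (1 - c) / 2 * f b)|
      ≤ L * ((b - a) / 2) ^ 2 * (1 - c ^ 2) := by
  rcases eq_or_lt_of_le hab with rfl | hab
  · have h1 : (a + a) / 2 - (a - a) / 2 * c = a := by ring
    rw [h1]
    have h2 : f a - ((1 + c) / 2 * f a + (1 - c) / 2 * f a) = 0 := by ring
    rw [h2]; simp
  rcases eq_or_lt_of_le hc with rfl | hc1
  · have h1 : (a + b) / 2 - (b - a) / 2 * (-1) = b := by ring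
    rw [h1]
    have h2 : f b - ((1 + (-1)) / 2 * f a + (1 - (-1)) / 2 * f b) = 0 := by ring
    rw [h2]; norm_num
  rcases eq_or_lt_of_le hc' with rfl | hc2
  · have h1 : (a + b) / 2 - (b - a) / 2 * 1 = a := by ring
    rw [h1]
    have h2 : f a - ((1 + 1) / 2 * f a + (1 - 1) / 2 * f b) = 0 := by ring
    rw [h2]; norm_num
  set h := (b - a) / 2 with hh
  set u := (a + b) / 2 - h * c with hu
  have hhpos : 0 < h := by rw [hh]; linarith
  have hau : u - a = h * (1 - c) := by rw [hu, hh]; ring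
  have hub : b - u = h * (1 + c) := by rw [hu, hh]; ring
  have hau' : a < u := by nlinarith
  have hub' : u < b := by nlinarith
  obtain ⟨x, hx, hxe⟩ := exists_hasDerivAt_eq_slope f g hau'
    (hf.mono (Icc_subset_Icc le_rfl hub'.le)) (fun v hv => hfg v ⟨hv.1, hv.2.trans hub'⟩)
  obtain ⟨y, hy, hye⟩ := exists_hasDerivAt_eq_slope f g hub'
    (hf.mono (Icc_subset_Icc hau'.le le_rfl)) (fun v hv => hfg v ⟨hau'.trans hv.1, hv.2⟩)
  rw [eq_div_iff (by linarith), hau] at hxe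
  rw [eq_div_iff (by linarith), hub] at hye
  have e : f u - ((1 + c) / 2 * f a + (1 - c) / 2 * f b)
      = (1 - c ^ 2) * h / 2 * (g x - g y) := by
    linear_combination (-(1 + c) / 2) * hxe + (1 - c) / 2 * hye
  have hc2' : 0 ≤ 1 - c ^ 2 := by nlinarith
  rw [e, abs_mul, abs_of_nonneg (by positivity)]
  have hg' := hg x ⟨hx.1, hx.2.trans hub'⟩ y ⟨hau'.trans hy.1, hy.2⟩
  have hL : 0 ≤ L := by
    by_contra hL
    have : 0 < |x - y| := abs_pos.2 (by have := hx.2; have := hy.1; intro; linarith)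
    nlinarith [abs_nonneg (g x - g y)]
  have hxy : |x - y| ≤ 2 * h := by
    rw [abs_le]; constructor <;> linarith [hx.1, hx.2, hy.1, hy.2]
  calc (1 - c ^ 2) * h / 2 * |g x - g y|
      ≤ (1 - c ^ 2) * h / 2 * (L * (2 * h)) := by
        gcongr
        exact hg'.trans (by gcongr)
    _ = L * h ^ 2 * (1 - c ^ 2) := by ring

theorem abs_sub_le_of_hasDerivAt_Ioo {g g' : ℝ → ℝ} {a b L : ℝ}
    (hg : ∀ u ∈ Ioo a b, HasDerivAt g (g' u) u) (hL : ∀ u ∈ Ioo a b, |g' u| ≤ L) :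
    ∀ u ∈ Ioo a b, ∀ v ∈ Ioo a b, |g u - g v| ≤ L * |u - v| := fun _ hu _ hv =>
  Convex.norm_image_sub_le_of_norm_hasDerivWithin_le
    (fun x hx => (hg x hx).hasDerivWithinAt) hL (convex_Ioo a b) hv hu

theorem abs_mul_cos_sub_sin_le {x : ℝ} (hx : 0 < x) : |x * cos x - sin x| ≤ x ^ 3 := by
  rw [abs_le]
  constructor
  · nlinarith [Real.one_sub_sq_div_two_le_cos (x := x), Real.sin_lt hx, pow_pos hx 3]
  · nlinarith [Real.sin_gt_sub_cube hx, Real.cos_le_one x, pow_pos hx 3]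

theorem abs_mul_cosh_sub_sinh_le {x : ℝ} (hx : 0 < x) (hx1 : x ≤ 1) :
    |x * cosh x - sinh x| ≤ x ^ 3 := by
  have hmono : MonotoneOn (fun x => x * cosh x - sinh x) (Ici 0) := by
    have hd : ∀ x : ℝ, HasDerivAt (fun x => x * cosh x - sinh x) (x * sinh x) x := fun x => by
      have := ((hasDerivAt_id x).mul (Real.hasDerivAt_cosh x)).sub (Real.hasDerivAt_sinh x)
      refine this.congr_deriv ?_
      simp only [id, one_mul]
      ring
    refine monotoneOn_of_deriv_nonneg (convex_Ici 0)
      (fun x _ => (hd x).continuousAt.continuousWithinAt)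
      (fun x _ => (hd x).differentiableAt.differentiableWithinAt) fun x hx => ?_
    rw [(hd x).deriv]
    rw [interior_Ici] at hx
    exact mul_nonneg (le_of_lt hx) (Real.sinh_nonneg_iff.2 (le_of_lt hx))
  have h0 : 0 ≤ x * cosh x - sinh x := by
    have := hmono (mem_Ici.2 le_rfl) (mem_Ici.2 hx.le) hx.le
    simpa using this
  rw [abs_of_nonneg h0]
  have hx2 : x ^ 2 / 2 ≤ 1 / 2 := by nlinarith
  have h1 : cosh x ≤ 1 + x ^ 2 := by
    refine (Real.cosh_le_exp_half_sq x).trans ?_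
    refine (Real.exp_bound_div_one_sub_of_interval (by positivity) (by linarith)).trans ?_
    rw [div_le_iff₀ (by linarith)]
    nlinarith [sq_nonneg x]
  have h2 : x ≤ sinh x := Real.self_le_sinh_iff.2 hx.le
  nlinarith

theorem abs_cos_interpolation_le {s t d e : ℝ} (hs : 0 < s) (ht : 0 < t) (hd : 0 ≤ d) (he : d ^ 2 = s ^ 2 + t ^ 2 - 2 * s * t * e)
    (he1 : -1 ≤ e) (he2 : e ≤ 1) :
    |cos d - cos s * cos t - e * (sin s * sin t)| ≤ 4 * (s * t) ^ 2 * (1 - e ^ 2) := by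
  have key := abs_sub_interpolation_le (f := fun u => cos (√u))
    (g := fun u => -(sin (√u) / (2 * √u))) (a := (s - t) ^ 2) (b := (s + t) ^ 2) (L := 1)
    (c := e) (by nlinarith [mul_pos hs ht]) (by fun_prop) ?_ ?_ he1 he2
  · have h1 : ((s - t) ^ 2 + (s + t) ^ 2) / 2 - ((s + t) ^ 2 - (s - t) ^ 2) / 2 * e = d ^ 2 := by
      rw [he]; ring
    simp only [h1, Real.sqrt_sq hd, Real.sqrt_sq_eq_abs, Real.cos_abs] at key
    rw [Real.cos_sub, Real.cos_add] at key
    convert key using 1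
    · congr 1; ring
    · ring
  · intro u hu
    have hu0 : 0 < u := lt_of_le_of_lt (sq_nonneg _) hu.1
    have := (Real.hasDerivAt_cos (√u)).comp u (Real.hasDerivAt_sqrt hu0.ne')
    refine this.congr_deriv ?_
    field_simp
  · refine abs_sub_le_of_hasDerivAt_Ioo
      (g' := fun u => -((√u * cos (√u) - sin (√u)) / (4 * √u ^ 3))) ?_ ?_
    · intro u hu
      have hu0 : 0 < u := lt_of_le_of_lt (sq_nonneg _) hu.1
      have hs0 : 0 < √u := Real.sqrt_pos.2 hu0
      have h1 := (Real.hasDerivAt_sin (√u)).comp u (Real.hasDerivAt_sqrt hu0.ne')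
      have h2 := (Real.hasDerivAt_sqrt hu0.ne').const_mul 2
      have := (h1.div h2 (by positivity)).neg
      refine this.congr_deriv ?_
      simp only [Function.comp]
      field_simp
      ring
    · intro u hu
      have hu0 : 0 < u := lt_of_le_of_lt (sq_nonneg _) hu.1
      have hs0 : 0 < √u := Real.sqrt_pos.2 hu0
      have := abs_mul_cos_sub_sin_le hs0
      rw [abs_neg, abs_div, abs_of_pos (by positivity : 0 < 4 * √u ^ 3),
        div_le_one (by positivity)]
      nlinarith [pow_pos hs0 3]

theorem abs_cosh_interpolation_le {s t d e : ℝ} (hs : 0 < s) (ht : 0 < t) (hs1 : s ≤ 1 / 2)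
    (ht1 : t ≤ 1 / 2) (hd : 0 ≤ d) (he : d ^ 2 = s ^ 2 + t ^ 2 - 2 * s * t * e)
    (he1 : -1 ≤ e) (he2 : e ≤ 1) :
    |cosh s * cosh t - cosh d - e * (sinh s * sinh t)| ≤ 4 * (s * t) ^ 2 * (1 - e ^ 2) := by
  have key := abs_sub_interpolation_le (f := fun u => cosh (√u))
    (g := fun u => sinh (√u) / (2 * √u)) (a := (s - t) ^ 2) (b := (s + t) ^ 2) (L := 1)
    (c := e) (by nlinarith [mul_pos hs ht])
    (Real.continuous_cosh.comp Real.continuous_sqrt).continuousOn ?_ ?_ he1 he2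
  · have h1 : ((s - t) ^ 2 + (s + t) ^ 2) / 2 - ((s + t) ^ 2 - (s - t) ^ 2) / 2 * e = d ^ 2 := by
      rw [he]; ring
    simp only [h1, Real.sqrt_sq hd, Real.sqrt_sq_eq_abs, Real.cosh_abs] at key
    rw [Real.cosh_sub, Real.cosh_add, ← abs_neg] at key
    convert key using 1
    · congr 1; ring
    · ring
  · intro u hu
    have hu0 : 0 < u := lt_of_le_of_lt (sq_nonneg _) hu.1
    have := (Real.hasDerivAt_cosh (√u)).comp u (Real.hasDerivAt_sqrt hu0.ne')
    refine this.congr_deriv ?_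
    field_simp
  · refine abs_sub_le_of_hasDerivAt_Ioo
      (g' := fun u => (√u * cosh (√u) - sinh (√u)) / (4 * √u ^ 3)) ?_ ?_
    · intro u hu
      have hu0 : 0 < u := lt_of_le_of_lt (sq_nonneg _) hu.1
      have hs0 : 0 < √u := Real.sqrt_pos.2 hu0
      have h1 := (Real.hasDerivAt_sinh (√u)).comp u (Real.hasDerivAt_sqrt hu0.ne')
      have h2 := (Real.hasDerivAt_sqrt hu0.ne').const_mul 2
      have := h1.div h2 (by positivity)
      refine this.congr_deriv ?_
      simp only [Function.comp]
      field_simp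
      ring
    · intro u hu
      have hu0 : 0 < u := lt_of_le_of_lt (sq_nonneg _) hu.1
      have hs0 : 0 < √u := Real.sqrt_pos.2 hu0
      have hs1' : √u ≤ 1 := by
        rw [Real.sqrt_le_one]
        nlinarith [hu.2]
      have := abs_mul_cosh_sub_sinh_le hs0 hs1'
      rw [abs_div, abs_of_pos (by positivity : 0 < 4 * √u ^ 3), div_le_one (by positivity)]
      nlinarith [pow_pos hs0 3]

/-! ### The model cosine -/

/-- The cosine of the comparison angle in the `κ`-plane, as an explicit formula. -/
noncomputable def modelCos (κ s t d : ℝ) : ℝ :=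
  if 0 < κ then
    (Real.cos (√κ * d) - Real.cos (√κ * s) * Real.cos (√κ * t)) /
      (Real.sin (√κ * s) * Real.sin (√κ * t))
  else if κ < 0 then
    (Real.cosh (√(-κ) * s) * Real.cosh (√(-κ) * t) - Real.cosh (√(-κ) * d)) /
      (Real.sinh (√(-κ) * s) * Real.sinh (√(-κ) * t))
  else (s ^ 2 + t ^ 2 - d ^ 2) / (2 * s * t)

/-- The cosine of the Euclidean comparison angle. -/
noncomputable def euclCos (s t d : ℝ) : ℝ := (s ^ 2 + t ^ 2 - d ^ 2) / (2 * s * t)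

theorem cangleK_eq_arccos (κ s t d : ℝ) : cangleK κ s t d = arccos (modelCos κ s t d) := by
  unfold cangleK modelCos
  split_ifs <;> rfl

theorem modelCos_comm (κ s t d : ℝ) : modelCos κ s t d = modelCos κ t s d := by
  unfold modelCos
  split_ifs
  · ring
  · ring
  · ring

theorem euclCos_comm (s t d : ℝ) : euclCos s t d = euclCos t s d := by
  unfold euclCos; ring

theorem sq_eq_of_euclCos {s t d : ℝ} (hs : 0 < s) (ht : 0 < t) :
    d ^ 2 = s ^ 2 + t ^ 2 - 2 * s * t * euclCos s t d := by
  unfold euclCos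
  field_simp
  ring

theorem neg_one_le_euclCos {s t d : ℝ} (hs : 0 < s) (ht : 0 < t) (hd : 0 ≤ d) (h : d ≤ s + t) :
    -1 ≤ euclCos s t d := by
  unfold euclCos
  rw [le_div_iff₀ (by positivity)]
  nlinarith

theorem euclCos_le_one {s t d : ℝ} (hs : 0 < s) (ht : 0 < t) (h : |s - t| ≤ d) :
    euclCos s t d ≤ 1 := by
  unfold euclCos
  rw [div_le_one (by positivity)]
  have := sq_le_sq' (by linarith [abs_nonneg (s - t)]) h
  rw [sq_abs] at this
  nlinarith

/-- Quadratic closeness of the model cosine and the Euclidean one. -/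
theorem abs_modelCos_sub_euclCos_le {κ s t d : ℝ} (hs : 0 < s) (ht : 0 < t)
    (hs1 : √|κ| * s ≤ 1 / 4) (ht1 : √|κ| * t ≤ 1 / 4) (h1 : |s - t| ≤ d) (h2 : d ≤ s + t) :
    |modelCos κ s t d - euclCos s t d| ≤ 10 * |κ| * (s * t) * (1 - euclCos s t d ^ 2) := by
  have hd : 0 ≤ d := (abs_nonneg _).trans h1
  have he1 := neg_one_le_euclCos hs ht hd h2
  have he2 := euclCos_le_one hs ht h1
  have he3 : 0 ≤ 1 - euclCos s t d ^ 2 := by nlinarith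
  have hsqd := sq_eq_of_euclCos (d := d) hs ht
  rcases lt_trichotomy κ 0 with hκ | rfl | hκ
  · have hk : 0 < √(-κ) := Real.sqrt_pos.2 (by linarith)
    rw [abs_of_neg hκ] at hs1 ht1 ⊢
    have hκ' : -κ = √(-κ) ^ 2 := (Real.sq_sqrt (by linarith)).symm
    rw [modelCos, if_neg (by linarith), if_pos hκ]
    have key := abs_cosh_interpolation_le (s := √(-κ) * s) (t := √(-κ) * t) (d := √(-κ) * d)
      (e := euclCos s t d) (by positivity) (by positivity) (by linarith) (by linarith)
      (by positivity) (by rw [mul_pow, hsqd]; ring) he1 he2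
    set k := √(-κ)
    have a1 : k * s ≤ sinh (k * s) := Real.self_le_sinh_iff.2 (by positivity)
    have a2 : k * t ≤ sinh (k * t) := Real.self_le_sinh_iff.2 (by positivity)
    have a3 : 0 < sinh (k * s) := lt_of_lt_of_le (by positivity) a1
    have a4 : 0 < sinh (k * t) := lt_of_lt_of_le (by positivity) a2
    have a5 : (k * s) * (k * t) ≤ sinh (k * s) * sinh (k * t) := by gcongr
    have a6 : 0 < (k * s) * (k * t) := by positivity
    rw [div_sub' (by positivity), abs_div, abs_of_pos (mul_pos a3 a4), div_le_iff₀ (mul_pos a3 a4),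
      mul_comm _ (euclCos s t d)]
    refine key.trans ?_
    rw [hκ']
    calc 4 * (k * s * (k * t)) ^ 2 * (1 - euclCos s t d ^ 2)
        = 4 * (k * s * (k * t)) * (1 - euclCos s t d ^ 2) * (k * s * (k * t)) := by ring
      _ ≤ 10 * (k * s * (k * t)) * (1 - euclCos s t d ^ 2) * (sinh (k * s) * sinh (k * t)) := by
        gcongr; norm_num
      _ = _ := by ring
  · simp [modelCos, euclCos]
  · have hk : 0 < √κ := Real.sqrt_pos.2 hκ
    rw [abs_of_pos hκ] at hs1 ht1 ⊢
    have hκ' : κ = √κ ^ 2 := (Real.sq_sqrt hκ.le).symm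
    rw [modelCos, if_pos hκ]
    have key := abs_cos_interpolation_le (s := √κ * s) (t := √κ * t) (d := √κ * d)
      (e := euclCos s t d) (by positivity) (by positivity)
      (by positivity) (by rw [mul_pow, hsqd]; ring) he1 he2
    have hpi := Real.pi_gt_three
    have b1 := Real.mul_le_sin (x := √κ * s) (by positivity) (by linarith)
    have b2 := Real.mul_le_sin (x := √κ * t) (by positivity) (by linarith)
    have hp : (317 : ℝ) / 500 ≤ 2 / π := by
      rw [div_le_div_iff₀ (by norm_num) Real.pi_pos]
      linarith [Real.pi_lt_d2]
    have a1 : 317 / 500 * (√κ * s) ≤ sin (√κ * s) := le_trans (by gcongr) b1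
    have a2 : 317 / 500 * (√κ * t) ≤ sin (√κ * t) := le_trans (by gcongr) b2
    set k := √κ
    have a3 : 0 < sin (k * s) := lt_of_lt_of_le (by positivity) a1
    have a4 : 0 < sin (k * t) := lt_of_lt_of_le (by positivity) a2
    have a5 : (317 / 500 * (k * s)) * (317 / 500 * (k * t)) ≤ sin (k * s) * sin (k * t) := by gcongr
    rw [div_sub' (by positivity), abs_div, abs_of_pos (mul_pos a3 a4), div_le_iff₀ (mul_pos a3 a4),
      mul_comm _ (euclCos s t d)]
    refine key.trans ?_
    rw [hκ']
    have a6 : 4 * ((k * s) * (k * t)) ≤ 10 * (sin (k * s) * sin (k * t)) := by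
      have : 0 < (k * s) * (k * t) := by positivity
      linarith
    calc 4 * (k * s * (k * t)) ^ 2 * (1 - euclCos s t d ^ 2)
        = 4 * ((k * s) * (k * t)) * ((k * s * (k * t)) * (1 - euclCos s t d ^ 2)) := by ring
      _ ≤ 10 * (sin (k * s) * sin (k * t)) * ((k * s * (k * t)) * (1 - euclCos s t d ^ 2)) := by
        gcongr
      _ = _ := by ring

theorem modelCos_mem_Icc {κ s t d : ℝ} (hs : 0 < s) (ht : 0 < t)
    (hs1 : √|κ| * s ≤ 1 / 8) (ht1 : √|κ| * t ≤ 1 / 8) (h1 : |s - t| ≤ d) (h2 : d ≤ s + t) :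
    modelCos κ s t d ∈ Icc (-1) 1 := by
  have hd : 0 ≤ d := (abs_nonneg _).trans h1
  have he1 := neg_one_le_euclCos hs ht hd h2
  have he2 := euclCos_le_one hs ht h1
  have key := abs_le.1 (abs_modelCos_sub_euclCos_le (κ := κ) hs ht (by linarith) (by linarith) h1 h2)
  have hst : |κ| * (s * t) ≤ 1 / 64 := by
    calc |κ| * (s * t) = (√|κ| * s) * (√|κ| * t) := by
          nth_rewrite 1 [← Real.sq_sqrt (abs_nonneg κ)]; ring
      _ ≤ 1 / 8 * (1 / 8) := by gcongr
      _ = 1 / 64 := by norm_num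
  have h3 : 10 * |κ| * (s * t) * (1 - euclCos s t d ^ 2) ≤ 1 / 2 * (1 - euclCos s t d ^ 2) := by
    have : 0 ≤ 1 - euclCos s t d ^ 2 := by nlinarith
    gcongr
    linarith
  constructor
  · nlinarith [key.1]
  · nlinarith [key.2]

theorem modelCos_eq_of_euclCos_sq {κ s t d : ℝ} (hs : 0 < s) (ht : 0 < t)
    (hs1 : √|κ| * s ≤ 1 / 4) (ht1 : √|κ| * t ≤ 1 / 4) (h1 : |s - t| ≤ d) (h2 : d ≤ s + t)
    (h : euclCos s t d ^ 2 = 1) : modelCos κ s t d = euclCos s t d := by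
  have key := abs_modelCos_sub_euclCos_le (κ := κ) hs ht hs1 ht1 h1 h2
  rw [h, sub_self, mul_zero] at key
  exact sub_eq_zero.1 (abs_nonpos_iff.1 key)

/-- Halving one side of a hinge does not increase the model cosine. -/
theorem modelCos_le_of_midpoint {κ s a b c : ℝ} (hs : 0 < s) (ha : 0 < a) (hb : 0 < b)
    (hs1 : √|κ| * s ≤ 1 / 4) (ha1 : √|κ| * a ≤ 1 / 4) (hb1 : √|κ| * b ≤ 1 / 4)
    (h : 0 ≤ modelCos κ s a b + modelCos κ s a c) :
    modelCos κ b s a ≤ modelCos κ b (2 * s) c := by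
  unfold modelCos at *
  have hpi := Real.pi_gt_three
  split_ifs at h ⊢ with h1 h2
  · rw [abs_of_pos h1] at hs1 ha1 hb1
    have hk : 0 < √κ := Real.sqrt_pos.2 h1
    set k := √κ
    have a1 : 0 < sin (k * s) := Real.sin_pos_of_pos_of_lt_pi (by positivity) (by linarith)
    have a2 : 0 < sin (k * a) := Real.sin_pos_of_pos_of_lt_pi (by positivity) (by linarith)
    have a3 : 0 < sin (k * b) := Real.sin_pos_of_pos_of_lt_pi (by positivity) (by linarith)
    have a4 : 0 < cos (k * s) :=
      Real.cos_pos_of_mem_Ioo ⟨by linarith [mul_pos hk hs], by linarith⟩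
    rw [← add_div, le_div_iff₀ (by positivity), zero_mul] at h
    rw [show k * (2 * s) = 2 * (k * s) by ring, Real.sin_two_mul, Real.cos_two_mul,
      div_le_div_iff₀ (by positivity) (by positivity)]
    have : 0 ≤ (cos (k * b) + cos (k * c) - 2 * cos (k * s) * cos (k * a)) *
      (sin (k * s) * sin (k * b)) := by
      apply mul_nonneg _ (by positivity)
      linarith
    nlinarith [this]
  · rw [abs_of_neg h2] at hs1 ha1 hb1
    have hk : 0 < √(-κ) := Real.sqrt_pos.2 (by linarith)
    set k := √(-κ)
    have a1 : 0 < sinh (k * s) := Real.sinh_pos_iff.2 (by positivity)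
    have a2 : 0 < sinh (k * a) := Real.sinh_pos_iff.2 (by positivity)
    have a3 : 0 < sinh (k * b) := Real.sinh_pos_iff.2 (by positivity)
    have a4 : 0 < cosh (k * s) := Real.cosh_pos _
    rw [← add_div, le_div_iff₀ (by positivity), zero_mul] at h
    rw [show k * (2 * s) = 2 * (k * s) by ring, Real.sinh_two_mul, Real.cosh_two_mul,
      div_le_div_iff₀ (by positivity) (by positivity), Real.sinh_sq]
    have : 0 ≤ (2 * cosh (k * s) * cosh (k * a) - cosh (k * b) - cosh (k * c)) *
      (sinh (k * s) * sinh (k * b)) := by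
      apply mul_nonneg _ (by positivity)
      linarith
    nlinarith [this]
  · rw [← add_div, le_div_iff₀ (by positivity), zero_mul] at h
    rw [div_le_div_iff₀ (by positivity) (by positivity)]
    have : 0 ≤ (2 * s ^ 2 + 2 * a ^ 2 - b ^ 2 - c ^ 2) * (s * b) := by
      apply mul_nonneg _ (by positivity)
      linarith
    nlinarith [this]

/-- If the model cosine of a hinge dominates that of another hinge with smaller sides, then so
does the Euclidean one, up to a small multiplicative error. -/
theorem one_sub_euclCos_mul_le {κ s t d s' t' d' : ℝ} (hs' : 0 < s') (ht' : 0 < t')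
    (hss : s' ≤ s) (htt : t' ≤ t)
    (hs1 : √|κ| * s ≤ 1 / 8) (ht1 : √|κ| * t ≤ 1 / 8) (h1 : |s - t| ≤ d) (h2 : d ≤ s + t)
    (h1' : |s' - t'| ≤ d') (h2' : d' ≤ s' + t')
    (h : modelCos κ s' t' d' ≤ modelCos κ s t d) :
    (1 - euclCos s t d) * (1 - 40 * |κ| * (s * t)) ≤ 1 - euclCos s' t' d' := by
  have hs : 0 < s := hs'.trans_le hss
  have ht : 0 < t := ht'.trans_le htt
  have hk := Real.sqrt_nonneg |κ|
  have hs1' : √|κ| * s' ≤ 1 / 8 := le_trans (by gcongr) hs1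
  have ht1' : √|κ| * t' ≤ 1 / 8 := le_trans (by gcongr) ht1
  have he1 := neg_one_le_euclCos hs ht ((abs_nonneg _).trans h1) h2
  have he2 := euclCos_le_one hs ht h1
  have he1' := neg_one_le_euclCos hs' ht' ((abs_nonneg _).trans h1') h2'
  have he2' := euclCos_le_one hs' ht' h1'
  have key := abs_le.1 (abs_modelCos_sub_euclCos_le (κ := κ) hs ht (by linarith) (by linarith) h1 h2)
  have key' := abs_le.1
    (abs_modelCos_sub_euclCos_le (κ := κ) hs' ht' (by linarith) (by linarith) h1' h2')
  set e := euclCos s t d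
  set e' := euclCos s' t' d'
  have hst : |κ| * (s * t) ≤ 1 / 64 := by
    calc |κ| * (s * t) = (√|κ| * s) * (√|κ| * t) := by
          nth_rewrite 1 [← Real.sq_sqrt (abs_nonneg κ)]; ring
      _ ≤ 1 / 8 * (1 / 8) := by gcongr
      _ = 1 / 64 := by norm_num
  have hst' : |κ| * (s' * t') ≤ |κ| * (s * t) := by gcongr
  set q := |κ| * (s * t)
  set q' := |κ| * (s' * t')
  have hq' : 0 ≤ q' := by positivity
  have k1 : 10 * |κ| * (s * t) * (1 - e ^ 2) ≤ 20 * q * (1 - e) := by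
    have : 0 ≤ q * (1 - e) ^ 2 := mul_nonneg (hq'.trans hst') (sq_nonneg _)
    have e1 : 10 * |κ| * (s * t) = 10 * q := by ring
    rw [e1]; nlinarith
  have k2 : 10 * |κ| * (s' * t') * (1 - e' ^ 2) ≤ 20 * q * (1 - e') := by
    have : 0 ≤ q' * (1 - e') ^ 2 := mul_nonneg hq' (sq_nonneg _)
    have : 0 ≤ (q - q') * (1 - e') := mul_nonneg (by linarith) (by linarith)
    have e1 : 10 * |κ| * (s' * t') = 10 * q' := by ring
    rw [e1]; nlinarith
  have k3 : (1 - e) * (1 - 20 * q) ≤ (1 - e') * (1 + 20 * q) := by nlinarith [key.1, key.2, key'.1, key'.2]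
  have e1 : 40 * |κ| * (s * t) = 40 * q := by ring
  rw [e1]
  have hq : 0 ≤ q := hq'.trans hst'
  have k4 : (1 - e) * (1 - 40 * q) * (1 + 20 * q) ≤ (1 - e) * (1 - 20 * q) := by
    nlinarith [mul_nonneg (sub_nonneg.2 he2) (sq_nonneg q)]
  have k5 : 0 < 1 + 20 * q := by positivity
  exact le_of_mul_le_mul_right (k4.trans k3) k5

/-! ### Hinges in Alexandrov spaces -/

/-- The cosine of the Euclidean comparison angle at `p`. -/
noncomputable def vcos {X : Type*} [MetricSpace X] (p x y : X) : ℝ :=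
  euclCos (dist p x) (dist p y) (dist x y)

theorem vcos_comm {X : Type*} [MetricSpace X] (p x y : X) : vcos p x y = vcos p y x := by
  rw [vcos, vcos, euclCos_comm, dist_comm x y]

theorem abs_dist_sub_dist_le_dist {X : Type*} [MetricSpace X] (p x y : X) :
    |dist p x - dist p y| ≤ dist x y := by
  rw [abs_le]
  constructor <;> linarith [dist_triangle p x y, dist_triangle p y x, dist_comm x y]

theorem dist_le_dist_add_dist {X : Type*} [MetricSpace X] (p x y : X) :
    dist x y ≤ dist p x + dist p y := by
  linarith [dist_triangle x p y, dist_comm x p]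

theorem neg_one_le_vcos {X : Type*} [MetricSpace X] {p x y : X} (hx : x ≠ p) (hy : y ≠ p) :
    -1 ≤ vcos p x y :=
  neg_one_le_euclCos (dist_pos.2 hx.symm) (dist_pos.2 hy.symm) dist_nonneg
    (dist_le_dist_add_dist _ _ _)

theorem vcos_le_one {X : Type*} [MetricSpace X] {p x y : X} (hx : x ≠ p) (hy : y ≠ p) :
    vcos p x y ≤ 1 :=
  euclCos_le_one (dist_pos.2 hx.symm) (dist_pos.2 hy.symm) (abs_dist_sub_dist_le_dist _ _ _)

/-- The law of cosines. -/
theorem dist_sq_eq {X : Type*} [MetricSpace X] {p x y : X} (hx : x ≠ p) (hy : y ≠ p) :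
    dist x y ^ 2 = dist p x ^ 2 + dist p y ^ 2 - 2 * dist p x * dist p y * vcos p x y :=
  sq_eq_of_euclCos (dist_pos.2 hx.symm) (dist_pos.2 hy.symm)

/-- The consequences of a lower curvature bound used below: points `pt w u i` dividing geodesics
in the ratio `2⁻ⁱ`, almost monotonicity of hinges, and the angle condition for triples of
directions two of which are almost opposite. -/
structure HingeSpace (X : Type*) [MetricSpace X] (C r : ℝ) (pt : X → X → ℕ → X) : Prop where
  C_nonneg : 0 ≤ C
  r_pos : 0 < r
  small : C * r ^ 2 ≤ 1 / 2
  dist_left : ∀ w u i, dist w (pt w u i) = dist w u / 2 ^ i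
  dist_right : ∀ w u i, dist (pt w u i) u = (1 - 1 / 2 ^ i) * dist w u
  hinge : ∀ w u v i j, u ≠ w → v ≠ w → dist w u ≤ r → dist w v ≤ r →
    (1 - vcos w u v) * (1 - C * (dist w u * dist w v)) ≤ 1 - vcos w (pt w u i) (pt w v j)
  opposite : ∀ μ > 0, ∃ δ > 0, ∃ ρ > 0, ∀ p a b x : X, a ≠ p → b ≠ p → x ≠ p →
    dist p a ≤ ρ → dist p b ≤ ρ → dist p x ≤ ρ → vcos p a b ≤ -1 + δ →
    -μ ≤ vcos p x a + vcos p x b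
  pt_pt : ∀ w u i j, pt w (pt w u i) j = pt w u (j + i)

/-- The cosine of the comparison angle in the `κ`-plane at `p`. -/
noncomputable def kcos {X : Type*} [MetricSpace X] (κ : ℝ) (p x y : X) : ℝ :=
  modelCos κ (dist p x) (dist p y) (dist x y)

theorem kcos_comm {X : Type*} [MetricSpace X] (κ : ℝ) (p x y : X) :
    kcos κ p x y = kcos κ p y x := by
  rw [kcos, kcos, modelCos_comm, dist_comm x y]

theorem cangle_eq_arccos_kcos {X : Type*} [MetricSpace X] (κ : ℝ) (q p r : X) :
    cangle κ q p r = arccos (kcos κ p q r) := cangleK_eq_arccos _ _ _ _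

theorem kcos_mem_Icc {X : Type*} [MetricSpace X] {κ : ℝ} {p x y : X} (hx : x ≠ p) (hy : y ≠ p)
    (hx1 : √|κ| * dist p x ≤ 1 / 8) (hy1 : √|κ| * dist p y ≤ 1 / 8) :
    kcos κ p x y ∈ Icc (-1) 1 :=
  modelCos_mem_Icc (dist_pos.2 hx.symm) (dist_pos.2 hy.symm) hx1 hy1
    (abs_dist_sub_dist_le_dist _ _ _) (dist_le_dist_add_dist _ _ _)

theorem abs_kcos_sub_vcos_le {X : Type*} [MetricSpace X] {κ : ℝ} {p x y : X} (hx : x ≠ p)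
    (hy : y ≠ p) (hx1 : √|κ| * dist p x ≤ 1 / 8) (hy1 : √|κ| * dist p y ≤ 1 / 8) :
    |kcos κ p x y - vcos p x y| ≤ 10 * |κ| * (dist p x * dist p y) := by
  refine (abs_modelCos_sub_euclCos_le (dist_pos.2 hx.symm) (dist_pos.2 hy.symm) (by linarith)
    (by linarith) (abs_dist_sub_dist_le_dist _ _ _) (dist_le_dist_add_dist _ _ _)).trans ?_
  refine mul_le_of_le_one_right (by positivity) ?_
  linarith [sq_nonneg (euclCos (dist p x) (dist p y) (dist x y))]

theorem add_nonneg_of_arccos_add_le {A B : ℝ} (hA : A ∈ Icc (-1) 1) (hB : B ∈ Icc (-1) 1)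
    (h : arccos A + arccos B ≤ π) : 0 ≤ A + B := by
  have h1 : arccos A ≤ arccos (-B) := by rw [Real.arccos_neg]; linarith
  have h2 := Real.cos_le_cos_of_nonneg_of_le_pi (Real.arccos_nonneg A) (Real.arccos_le_pi _) h1
  rw [Real.cos_arccos hA.1 hA.2, Real.cos_arccos (by linarith [hB.2]) (by linarith [hB.1])] at h2
  linarith

theorem kcos_midpoint_le {X : Type*} [MetricSpace X] {κ : ℝ} (hX : IsAlexandrov X κ)
    {w u v m : X} (hu : u ≠ w) (hv : v ≠ w) (hu1 : √|κ| * dist w u ≤ 1 / 16)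
    (hv1 : √|κ| * dist w v ≤ 1 / 16) (hm1 : dist w m = dist w u / 2)
    (hm2 : dist m u = dist w u / 2) : kcos κ w m v ≤ kcos κ w u v := by
  have hu0 : 0 < dist w u := dist_pos.2 hu.symm
  have hv0 : 0 < dist w v := dist_pos.2 hv.symm
  have hk := Real.sqrt_nonneg |κ|
  have hmw : w ≠ m := by
    rintro rfl
    rw [dist_self] at hm1; linarith
  have hmu : u ≠ m := by
    rintro rfl
    rw [dist_self] at hm2; linarith
  rw [kcos_comm, kcos_comm _ _ u]
  unfold kcos
  rw [dist_comm v m, dist_comm v u, hm1]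
  by_cases hvm : v = m
  · subst hvm
    rw [dist_self, dist_comm u v, hm2, hm1]
    have e1 : euclCos (dist w u / 2) (dist w u / 2) 0 = 1 := by
      unfold euclCos; field_simp; norm_num
    have e2 : euclCos (dist w u / 2) (dist w u) (dist w u / 2) = 1 := by
      unfold euclCos; field_simp; norm_num
    rw [modelCos_eq_of_euclCos_sq (by linarith) (by linarith) (by linarith) (by linarith)
      (by simp) (by linarith) (by rw [e1]; norm_num), modelCos_eq_of_euclCos_sq (by linarith)
      (by linarith) (by linarith) (by linarith) (by rw [abs_le]; constructor <;> linarith)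
      (by linarith) (by rw [e2]; norm_num), e1, e2]
  · have ha0 : 0 < dist m v := dist_pos.2 (Ne.symm hvm)
    have ha1 : √|κ| * dist m v ≤ 1 / 8 := by
      calc √|κ| * dist m v ≤ √|κ| * (dist w u + dist w v) := by
            gcongr
            linarith [dist_triangle m w v, dist_comm m w]
        _ ≤ 1 / 8 := by linarith
    have hq := hX.2.2 m w u v hmw hmu hvm
    simp only [cangle_eq_arccos_kcos] at hq
    have hs1 : √|κ| * (dist w u / 2) ≤ 1 / 8 := by linarith
    have e1 : kcos κ m w u = -1 := by
      have e : euclCos (dist w u / 2) (dist w u / 2) (dist w u) = -1 := by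
        unfold euclCos; field_simp; norm_num
      rw [kcos, dist_comm m w, hm1, hm2, modelCos_eq_of_euclCos_sq (by linarith) (by linarith)
        (by linarith) (by linarith) (by rw [sub_self, abs_zero]; linarith) (by linarith)
        (by rw [e]; norm_num), e]
    rw [e1, Real.arccos_neg_one] at hq
    have h0 := add_nonneg_of_arccos_add_le
      (kcos_mem_Icc (κ := κ) (p := m) (x := u) (y := v) hmu hvm (by rw [hm2]; exact hs1) ha1)
      (kcos_mem_Icc (κ := κ) (p := m) (x := v) (y := w) hvm hmw ha1
        (by rw [dist_comm, hm1]; exact hs1)) (by linarith)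
    rw [kcos_comm _ _ v w] at h0
    unfold kcos at h0
    rw [dist_comm m w, hm1, hm2] at h0
    have := modelCos_le_of_midpoint (κ := κ) (s := dist w u / 2) (a := dist m v) (b := dist w v)
      (c := dist u v) (by linarith) ha0 hv0 (by linarith) (by linarith) (by linarith)
      (by linarith)
    rwa [show 2 * (dist w u / 2) = dist w u by ring, dist_comm u v, dist_comm v u] at this

theorem dist_iterate_left {X : Type*} [MetricSpace X] {w : X} {f : X → X}
    (hf : ∀ u, dist w (f u) = dist w u / 2) (u : X) (i : ℕ) :
    dist w (f^[i] u) = dist w u / 2 ^ i := by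
  induction i with
  | zero => simp
  | succ i ih => rw [Function.iterate_succ_apply', hf, ih, pow_succ, div_div]

theorem dist_iterate_right {X : Type*} [MetricSpace X] {w : X} {f : X → X}
    (hf : ∀ u, dist w (f u) = dist w u / 2) (hf' : ∀ u, dist (f u) u = dist w u / 2) (u : X)
    (i : ℕ) : dist (f^[i] u) u = (1 - 1 / 2 ^ i) * dist w u := by
  apply le_antisymm
  · induction i with
    | zero => simp
    | succ i ih =>
      have h1 := dist_triangle (f^[i + 1] u) (f^[i] u) u
      rw [Function.iterate_succ_apply'] at h1 ⊢
      rw [hf', dist_iterate_left hf] at h1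
      have : dist w u / 2 ^ i / 2 + (1 - 1 / 2 ^ i) * dist w u
          = (1 - 1 / 2 ^ (i + 1)) * dist w u := by
        rw [pow_succ]; field_simp; ring
      linarith
  · have h1 := dist_triangle w (f^[i] u) u
    rw [dist_iterate_left hf] at h1
    have : (1 - 1 / 2 ^ i) * dist w u = dist w u - dist w u / 2 ^ i := by ring
    linarith

theorem iterate_ne {X : Type*} [MetricSpace X] {w : X} {f : X → X}
    (hf : ∀ u, dist w (f u) = dist w u / 2) {u : X} (hu : u ≠ w) (i : ℕ) : f^[i] u ≠ w := by
  have h : 0 < dist w (f^[i] u) := by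
    rw [dist_iterate_left hf]
    have := dist_pos.2 hu.symm
    positivity
  exact (dist_pos.1 h).symm

theorem kcos_iterate_le {X : Type*} [MetricSpace X] {κ : ℝ} (hX : IsAlexandrov X κ)
    {w : X} {f : X → X} (hf : ∀ u, dist w (f u) = dist w u / 2)
    (hf' : ∀ u, dist (f u) u = dist w u / 2) {u v : X} (hu : u ≠ w) (hv : v ≠ w)
    (hu1 : √|κ| * dist w u ≤ 1 / 16) (hv1 : √|κ| * dist w v ≤ 1 / 16) (i : ℕ) :
    kcos κ w (f^[i] u) v ≤ kcos κ w u v := by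
  induction i with
  | zero => simp
  | succ i ih =>
    rw [Function.iterate_succ_apply']
    refine (kcos_midpoint_le hX (iterate_ne hf hu i) hv ?_ hv1 (hf _) (hf' _)).trans ih
    rw [dist_iterate_left hf]
    refine le_trans ?_ hu1
    gcongr
    exact div_le_self dist_nonneg (one_le_pow₀ one_le_two)

theorem exists_pos_mul_le (c : ℝ) {η : ℝ} (hη : 0 < η) :
    ∃ ρ > 0, ∀ x, 0 ≤ x → x ≤ ρ → c * x ≤ η := by
  refine ⟨η / (|c| + 1), by positivity, fun x hx0 hx => ?_⟩
  calc c * x ≤ (|c| + 1) * x := by gcongr; linarith [le_abs_self c]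
    _ ≤ (|c| + 1) * (η / (|c| + 1)) := by gcongr
    _ = η := by field_simp

theorem exists_arccos_ge {μ : ℝ} (hμ : 0 < μ) :
    ∃ δ > 0, ∀ x, x ≤ -1 + δ → π - μ ≤ arccos x := by
  have h : ∀ᶠ x in nhds (-1 : ℝ), π - μ < arccos x :=
    (Real.continuous_arccos.tendsto (-1)).eventually
      (lt_mem_nhds (by rw [Real.arccos_neg_one]; linarith))
  obtain ⟨δ, hδ, hb⟩ := Metric.eventually_nhds_iff.1 h
  refine ⟨δ / 2, by linarith, fun x hx => ?_⟩
  have := hb (y := -1 + δ / 2) (by simp [abs_of_pos hδ]; linarith)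
  exact this.le.trans (Real.antitone_arccos hx)

theorem neg_le_cos_add_cos {a b μ : ℝ} (ha : 0 ≤ a) (hb : b ∈ Icc 0 π) (hμ : 0 ≤ μ)
    (h : a + b ≤ π + μ) : -μ ≤ cos a + cos b := by
  rcases le_total a (π - b) with h1 | h1
  · have := Real.cos_le_cos_of_nonneg_of_le_pi ha (by linarith [hb.1]) h1
    rw [Real.cos_pi_sub] at this
    linarith
  · have h2 := abs_le.1 (Real.abs_cos_sub_cos_le a (π - b))
    rw [Real.cos_pi_sub, abs_of_nonneg (by linarith)] at h2
    linarith [h2.1]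

theorem exists_hingeSpace {X : Type*} [MetricSpace X] {κ : ℝ} (hX : IsAlexandrov X κ) :
    ∃ (r : ℝ) (pt : X → X → ℕ → X), HingeSpace X (40 * |κ|) r pt ∧ √|κ| * r ≤ 1 / 16 := by
  choose mid hm1 hm2 using hX.2.1
  have hk := Real.sqrt_nonneg |κ|
  obtain ⟨r, hr, hkr⟩ := exists_pos_mul_le (√|κ|) (η := 1 / 16) (by norm_num)
  have hkr1 := hkr r hr.le le_rfl
  refine ⟨r, fun w u i => (mid w)^[i] u, ⟨by positivity, hr, ?_, ?_, ?_, ?_, ?_,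
    fun w u i j => (Function.iterate_add_apply (mid w) j i u).symm⟩, hkr1⟩
  · calc 40 * |κ| * r ^ 2 = 40 * (√|κ| * r) ^ 2 := by rw [mul_pow, Real.sq_sqrt (abs_nonneg κ)]; ring
      _ ≤ 40 * (1 / 16) ^ 2 := by gcongr
      _ ≤ 1 / 2 := by norm_num
  · exact fun w u i => dist_iterate_left (hm1 w) u i
  · exact fun w u i => dist_iterate_right (hm1 w) (hm2 w) u i
  · intro w u v i j hu hv hur hvr
    have hui := iterate_ne (hm1 w) hu i
    have hvj := iterate_ne (hm1 w) hv j
    have hu1 := hkr _ dist_nonneg hur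
    have hv1 := hkr _ dist_nonneg hvr
    have hule : dist w ((mid w)^[i] u) ≤ dist w u := by
      rw [dist_iterate_left (hm1 w)]
      exact div_le_self dist_nonneg (one_le_pow₀ one_le_two)
    have hvle : dist w ((mid w)^[j] v) ≤ dist w v := by
      rw [dist_iterate_left (hm1 w)]
      exact div_le_self dist_nonneg (one_le_pow₀ one_le_two)
    refine one_sub_euclCos_mul_le (dist_pos.2 hui.symm) (dist_pos.2 hvj.symm) hule hvle
      (by linarith) (by linarith) (abs_dist_sub_dist_le_dist _ _ _) (dist_le_dist_add_dist _ _ _)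
      (abs_dist_sub_dist_le_dist _ _ _) (dist_le_dist_add_dist _ _ _) ?_
    refine (kcos_iterate_le hX (hm1 w) (hm2 w) hu hvj hu1 (hkr _ dist_nonneg (hvle.trans hvr))
      i).trans ?_
    change _ ≤ kcos κ w u v
    rw [kcos_comm, kcos_comm κ w u]
    exact kcos_iterate_le hX (hm1 w) (hm2 w) hv hu hv1 hu1 j
  · intro μ hμ
    obtain ⟨δ, hδ, hacos⟩ := exists_arccos_ge (μ := μ / 2) (by linarith)
    obtain ⟨ρ₁, hρ₁, hs⟩ := exists_pos_mul_le (10 * |κ|) (η := min (δ / 2) (μ / 4))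
      (lt_min (by linarith) (by linarith))
    refine ⟨δ / 2, by linarith, min (min r 1) ρ₁, lt_min (lt_min hr one_pos) hρ₁, ?_⟩
    intro p a b x ha hb hx har hbr hxr hab
    have hsmall : ∀ y z : X, dist p y ≤ min (min r 1) ρ₁ → dist p z ≤ min (min r 1) ρ₁ →
        10 * |κ| * (dist p y * dist p z) ≤ min (δ / 2) (μ / 4) := fun y z hy hz => by
      refine hs _ (by positivity) ?_
      calc dist p y * dist p z ≤ 1 * ρ₁ := by
            gcongr
            · exact hy.trans ((min_le_left _ _).trans (min_le_right _ _))
            · exact hz.trans (min_le_right _ _)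
        _ = ρ₁ := one_mul _
    have h8 : ∀ y : X, dist p y ≤ min (min r 1) ρ₁ → √|κ| * dist p y ≤ 1 / 8 := fun y hy => by
      have := hkr _ dist_nonneg (hy.trans ((min_le_left _ _).trans (min_le_left _ _)))
      linarith
    have kab := abs_le.1 (abs_kcos_sub_vcos_le ha hb (h8 a har) (h8 b hbr))
    have kxa := abs_le.1 (abs_kcos_sub_vcos_le hx ha (h8 x hxr) (h8 a har))
    have kxb := abs_le.1 (abs_kcos_sub_vcos_le hx hb (h8 x hxr) (h8 b hbr))
    have sab := (le_min_iff.1 (hsmall a b har hbr)).1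
    have sxa := (le_min_iff.1 (hsmall x a hxr har)).2
    have sxb := (le_min_iff.1 (hsmall x b hxr hbr)).2
    have hq := hX.2.2 p a b x ha hb hx
    simp only [cangle_eq_arccos_kcos] at hq
    have h1 := hacos (kcos κ p a b) (by linarith [kab.2])
    have h2 := neg_le_cos_add_cos (μ := μ / 2) (Real.arccos_nonneg (kcos κ p b x))
      ⟨Real.arccos_nonneg (kcos κ p x a), Real.arccos_le_pi _⟩ (by linarith) (by linarith)
    have mxa := kcos_mem_Icc hx ha (h8 x hxr) (h8 a har)
    have mxb := kcos_mem_Icc hx hb (h8 x hxr) (h8 b hbr)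
    rw [kcos_comm κ p b x, Real.cos_arccos mxa.1 mxa.2, Real.cos_arccos mxb.1 mxb.2] at h2
    linarith [kxa.2, kxb.2]

theorem neg_le_vcos_of_cangle_le {X : Type*} [MetricSpace X] {κ : ℝ} {q p z : X} (hq : q ≠ p)
    (hz : z ≠ p) (hq1 : √|κ| * dist p q ≤ 1 / 8) (hz1 : √|κ| * dist p z ≤ 1 / 8)
    (h : cangle κ q p z ≤ π / 2) : -(40 * |κ| * (dist p q * dist p z)) ≤ vcos p q z := by
  rw [cangle_eq_arccos_kcos, Real.arccos_le_pi_div_two] at h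
  have := abs_le.1 (abs_kcos_sub_vcos_le hq hz hq1 hz1)
  have h0 : 0 ≤ |κ| * (dist p q * dist p z) := by positivity
  linarith [this.2]

namespace HingeSpace

variable {X : Type*} [MetricSpace X] {C r : ℝ} {pt : X → X → ℕ → X}

theorem pt_ne (H : HingeSpace X C r pt) {w u : X} (hu : u ≠ w) (i : ℕ) : pt w u i ≠ w := by
  have h : 0 < dist w (pt w u i) := by
    rw [H.dist_left]
    have := dist_pos.2 hu.symm
    positivity
  exact (dist_pos.1 h).symm

theorem pt_zero (H : HingeSpace X C r pt) (w u : X) : pt w u 0 = u := by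
  rw [← dist_eq_zero, H.dist_right]
  norm_num

theorem pt_self (H : HingeSpace X C r pt) (w : X) (i : ℕ) : pt w w i = w := by
  rw [eq_comm, ← dist_eq_zero, H.dist_left, dist_self, zero_div]

theorem dist_pt_le (H : HingeSpace X C r pt) (w u : X) (i : ℕ) :
    dist w (pt w u i) ≤ dist w u := by
  rw [H.dist_left]
  exact div_le_self dist_nonneg (one_le_pow₀ one_le_two)

theorem mul_mul_le (H : HingeSpace X C r pt) {s t : ℝ} (hs : s ≤ r) (ht0 : 0 ≤ t) (ht : t ≤ r) :
    C * (s * t) ≤ 1 / 2 := by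
  refine le_trans ?_ H.small
  rw [pow_two]
  have := H.C_nonneg
  have := H.r_pos.le
  gcongr

/-- Additive form of the almost monotonicity of hinges. -/
theorem vcos_pt_le (H : HingeSpace X C r pt) {w u v : X} (hu : u ≠ w) (hv : v ≠ w)
    (hur : dist w u ≤ r) (hvr : dist w v ≤ r) (i j : ℕ) :
    vcos w (pt w u i) (pt w v j) ≤ vcos w u v + 2 * C * (dist w u * dist w v) := by
  have h := H.hinge w u v i j hu hv hur hvr
  have h1 := neg_one_le_vcos hu hv
  have h2 : 0 ≤ C * (dist w u * dist w v) := mul_nonneg H.C_nonneg (by positivity)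
  nlinarith

theorem half_dist_le (H : HingeSpace X C r pt) {w u v : X} (hur : dist w u ≤ r)
    (hvr : dist w v ≤ r) (i : ℕ) : dist u v / 2 / 2 ^ i ≤ dist (pt w u i) (pt w v i) := by
  by_cases hu : u = w
  · rw [hu, H.pt_self, H.dist_left]
    gcongr
    linarith [dist_nonneg (x := w) (y := v)]
  by_cases hv : v = w
  · rw [hv, H.pt_self, dist_comm u w, dist_comm (pt _ _ _) w, H.dist_left]
    gcongr
    linarith [dist_nonneg (x := w) (y := u)]
  have h := H.hinge w u v i i hu hv hur hvr
  have h1 := dist_sq_eq hu hv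
  have h2 := dist_sq_eq (H.pt_ne hu i) (H.pt_ne hv i)
  rw [H.dist_left, H.dist_left] at h2
  have h3 := H.mul_mul_le hur dist_nonneg hvr
  have h4 := vcos_le_one hu hv
  refine abs_le_of_sq_le_sq' ?_ dist_nonneg |>.2
  set e := vcos w u v
  set e' := vcos w (pt w u i) (pt w v i)
  have hs := dist_nonneg (x := w) (y := u)
  have ht := dist_nonneg (x := w) (y := v)
  set s := dist w u
  set t := dist w v
  have h5 : (1 - e) / 2 ≤ 1 - e' := by nlinarith
  have h6 : dist u v ^ 2 / 4 ≤ s ^ 2 + t ^ 2 - 2 * s * t * e' := by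
    nlinarith [mul_nonneg hs ht, sq_nonneg (s - t), mul_le_mul_of_nonneg_left h5 (mul_nonneg hs ht),
      mul_nonneg (mul_nonneg hs ht) (sub_nonneg.2 h4)]
  calc (dist u v / 2 / 2 ^ i) ^ 2 = dist u v ^ 2 / 4 / (2 ^ i) ^ 2 := by ring
    _ ≤ (s ^ 2 + t ^ 2 - 2 * s * t * e') / (2 ^ i) ^ 2 := by gcongr
    _ = _ := by rw [h2]; ring

end HingeSpace

/-- The ball of radius `ρ` at `p` contains `N` points with pairwise distances at least `c * ρ`. -/
def Pack {X : Type*} [MetricSpace X] (N : ℕ) (c : ℝ) (p : X) (ρ : ℝ) : Prop :=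
  ∃ u : Fin N → X, (∀ i, dist p (u i) < ρ) ∧ ∀ i j, i ≠ j → c * ρ ≤ dist (u i) (u j)

theorem Pack.mono {X : Type*} [MetricSpace X] {N M : ℕ} {c : ℝ} {p : X} {ρ : ℝ}
    (h : Pack N c p ρ) (hM : M ≤ N) : Pack M c p ρ := by
  obtain ⟨u, h1, h2⟩ := h
  exact ⟨fun i => u (Fin.castLE hM i), fun i => h1 _, fun i j hij =>
    h2 _ _ fun h => hij (Fin.castLE_injective hM h)⟩

theorem exists_div_two_pow_le {a b : ℝ} (hb : 0 < b) : ∃ j : ℕ, a / 2 ^ j ≤ b := by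
  obtain ⟨j, hj⟩ := pow_unbounded_of_one_lt (a / b) (one_lt_two (α := ℝ))
  refine ⟨j, ?_⟩
  rw [div_lt_iff₀ hb] at hj
  rw [div_le_iff₀ (by positivity)]
  linarith

theorem HingeSpace.exists_pack {X : Type*} [MetricSpace X] {C r : ℝ} {pt : X → X → ℕ → X}
    (H : HingeSpace X C r pt) {N : ℕ} {c : ℝ} {p w : X} {ρ η : ℝ} (h : Pack N c p ρ)
    (hw : dist p w < ρ) (hρ : 2 * ρ ≤ r) (hη : 0 < η) :
    ∃ ρ' > 0, ρ' ≤ η ∧ Pack N (c / 4) w ρ' := by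
  have hρ0 : 0 < ρ := dist_nonneg.trans_lt hw
  obtain ⟨j, hj⟩ := exists_div_two_pow_le (a := 2 * ρ) hη
  obtain ⟨u, h1, h2⟩ := h
  have h3 : ∀ i, dist w (u i) < 2 * ρ := fun i => by
    linarith [dist_triangle w p (u i), dist_comm w p, h1 i]
  refine ⟨2 * ρ / 2 ^ j, by positivity, hj, fun i => pt w (u i) j, fun i => ?_, fun i k hik => ?_⟩
  · rw [H.dist_left]
    gcongr
    exact h3 i
  · refine le_trans ?_ (H.half_dist_le ((h3 i).le.trans hρ) ((h3 k).le.trans hρ) j)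
    calc c / 4 * (2 * ρ / 2 ^ j) = c * ρ / 2 / 2 ^ j := by ring
      _ ≤ _ := by gcongr; exact h2 i k hik

/-- Boxed pigeonhole principle. -/
theorem exists_ne_forall_abs_sub_le (ι : Type*) [Fintype ι] (A : ℝ) :
    ∃ N : ℕ, ∀ (F : Fin N → ι → ℝ) (h : ℝ), 0 < h → (∀ i a, |F i a| ≤ A * h) →
      ∃ i j, i ≠ j ∧ ∀ a, |F i a - F j a| ≤ h := by
  classical
  let K : ℤ := ⌈A⌉ + 1
  refine ⟨Fintype.card (ι → Finset.Icc (-K) K) + 1, fun F h hh hF => ?_⟩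
  have hmem : ∀ i a, ⌊F i a / h⌋ ∈ Finset.Icc (-K) K := fun i a => by
    have h1 := abs_le.1 (hF i a)
    have h2 : F i a / h ≤ A := by rw [div_le_iff₀ hh]; exact h1.2
    have h3 : -A ≤ F i a / h := by rw [le_div_iff₀ hh]; linarith [h1.1]
    have h4 : A ≤ ⌈A⌉ := Int.le_ceil A
    rw [Finset.mem_Icc]
    constructor
    · rw [Int.le_floor]
      push_cast [K]
      linarith
    · have : ((⌊F i a / h⌋ : ℤ) : ℝ) ≤ (K : ℝ) := by
        push_cast [K]
        linarith [Int.floor_le (F i a / h)]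
      exact_mod_cast this
  obtain ⟨i, j, hij, he⟩ := Fintype.exists_ne_map_eq_of_card_lt
    (fun i a => (⟨⌊F i a / h⌋, hmem i a⟩ : Finset.Icc (-K) K)) (by simp)
  refine ⟨i, j, hij, fun a => ?_⟩
  have h1 : ⌊F i a / h⌋ = ⌊F j a / h⌋ := congrArg Subtype.val (congrFun he a)
  have h2 := Int.abs_sub_lt_one_of_floor_eq_floor h1
  rw [← sub_div, abs_div, abs_of_pos hh, div_lt_one hh] at h2
  exact h2.le

/-! ### Strainers -/

/-- `k` pairs of almost opposite, pairwise almost orthogonal directions at `p`. -/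
structure Strained {X : Type*} [MetricSpace X] {k : ℕ} (δ R : ℝ) (c : Fin k → Bool → X)
    (p : X) : Prop where
  ne : ∀ i e, c i e ≠ p
  dist_lt : ∀ i e, dist p (c i e) < R
  opp : ∀ i, vcos p (c i true) (c i false) < -1 + δ
  orth : ∀ i j, i ≠ j → ∀ e f, vcos p (c i e) (c j f) < δ

theorem Strained.mono {X : Type*} [MetricSpace X] {k : ℕ} {δ δ' R R' : ℝ} {c : Fin k → Bool → X}
    {p : X} (h : Strained δ R c p) (hδ : δ ≤ δ') (hR : R ≤ R') : Strained δ' R' c p :=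
  ⟨h.ne, fun i e => (h.dist_lt i e).trans_le hR, fun i => (h.opp i).trans_le (by linarith),
    fun i j hij e f => (h.orth i j hij e f).trans_le hδ⟩

theorem continuousAt_vcos {X : Type*} [MetricSpace X] {p x y : X} (hx : x ≠ p) (hy : y ≠ p) :
    ContinuousAt (fun q => vcos q x y) p := by
  unfold vcos euclCos
  have h1 := dist_pos.2 hx.symm
  have h2 := dist_pos.2 hy.symm
  refine ContinuousAt.div (by fun_prop) (by fun_prop) (by positivity)

theorem Strained.eventually {X : Type*} [MetricSpace X] {k : ℕ} {δ R : ℝ} {c : Fin k → Bool → X}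
    {p : X} (h : Strained δ R c p) : ∀ᶠ q in nhds p, Strained δ R c q := by
  have h1 : ∀ᶠ q in nhds p, ∀ i e, c i e ≠ q :=
    Filter.eventually_all.2 fun i => Filter.eventually_all.2 fun e =>
      (eventually_ne_nhds (h.ne i e).symm).mono fun _ hq => hq.symm
  have h2 : ∀ᶠ q in nhds p, ∀ i e, dist q (c i e) < R :=
    Filter.eventually_all.2 fun i => Filter.eventually_all.2 fun e =>
      (by fun_prop : ContinuousAt (fun q => dist q (c i e)) p).eventually
        (gt_mem_nhds (h.dist_lt i e))
  have h3 : ∀ᶠ q in nhds p, ∀ i, vcos q (c i true) (c i false) < -1 + δ :=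
    Filter.eventually_all.2 fun i => (continuousAt_vcos (h.ne _ _) (h.ne _ _)).eventually
        (gt_mem_nhds (h.opp i))
  have h4 : ∀ᶠ q in nhds p, ∀ i j, i ≠ j → ∀ e f, vcos q (c i e) (c j f) < δ :=
    Filter.eventually_all.2 fun i => Filter.eventually_all.2 fun j =>
      Filter.eventually_all.2 fun hij => Filter.eventually_all.2 fun e =>
      Filter.eventually_all.2 fun f => (continuousAt_vcos (h.ne _ _) (h.ne _ _)).eventually
        (gt_mem_nhds (h.orth i j hij e f))
  filter_upwards [h1, h2, h3, h4] with q q1 q2 q3 q4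
  exact ⟨q1, q2, q3, q4⟩

/-- Supplementary angles at an interior point and at an endpoint of a short segment. -/
theorem vcos_add_vcos_le {X : Type*} [MetricSpace X] {w x c : X} {D : ℝ} (hx : x ≠ w)
    (hD : 0 < D) (hw : D ≤ dist w c) (hxc : D ≤ dist x c) :
    vcos x w c + vcos w x c ≤ dist w x / D := by
  have h0 := dist_pos.2 hx.symm
  unfold vcos euclCos
  rw [dist_comm x w]
  have ha : 0 < dist x c := hD.trans_le hxc
  have hb : 0 < dist w c := hD.trans_le hw
  set σ := dist w x
  set a := dist x c
  set b := dist w c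
  have e : (σ ^ 2 + a ^ 2 - b ^ 2) / (2 * σ * a) + (σ ^ 2 + b ^ 2 - a ^ 2) / (2 * σ * b)
      = σ / 2 * (1 / a + 1 / b) - (a - b) ^ 2 * (a + b) / (2 * σ * a * b) := by
    field_simp
    ring
  have h1 : 1 / a ≤ 1 / D := one_div_le_one_div_of_le hD hxc
  have h2 : 1 / b ≤ 1 / D := one_div_le_one_div_of_le hD hw
  have h3 : 0 ≤ (a - b) ^ 2 * (a + b) / (2 * σ * a * b) := by positivity
  rw [e]
  calc _ ≤ σ / 2 * (1 / D + 1 / D) := by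
        have : σ / 2 * (1 / a + 1 / b) ≤ σ / 2 * (1 / D + 1 / D) := by gcongr
        linarith
    _ = σ / D := by ring

/-- Lower bound for the angles between the two halves of a segment `xy` with midpoint `w` and a
point `c` almost equidistant from `x` and `y`. -/
theorem neg_le_vcos_of_abs_sub_le {X : Type*} [MetricSpace X] {w x y c : X} {μ δ : ℝ}
    (hx : x ≠ w) (hwy : dist w y = dist w x) (hxy : dist x y = 2 * dist w x)
    (hc : 2 * dist w x ≤ dist w c) (hd : |dist x c - dist y c| ≤ δ * dist x y)
    (hq : -μ ≤ vcos w c x + vcos w c y) : -(μ + 3 * δ) / 2 ≤ vcos w x c := by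
  rw [vcos_comm w c x, vcos_comm w c y] at hq
  have h0 := dist_pos.2 hx.symm
  have hb : 0 < dist w c := by linarith
  have hxc := dist_triangle x w c
  have hyc := dist_triangle y w c
  rw [dist_comm x w] at hxc
  rw [dist_comm y w] at hyc
  have hdy : vcos w y c - vcos w x c ≤ 3 * δ := by
    unfold vcos euclCos
    rw [hwy]
    rw [hxy] at hd
    have hd' := abs_le.1 hd
    have p1 := dist_nonneg (x := x) (y := c)
    have p2 := dist_nonneg (x := y) (y := c)
    set σ := dist w x
    set a := dist x c
    set a' := dist y c
    set b := dist w c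
    have hδ : 0 ≤ δ := by
      by_contra hδ
      have := abs_nonneg (a - a')
      nlinarith
    rw [← sub_div, div_le_iff₀ (by positivity)]
    have h1 : (a - a') * (a + a') ≤ (δ * (2 * σ)) * (a + a') := by
      gcongr; exact hd'.2
    have h2 : (δ * (2 * σ)) * (a + a') ≤ (δ * (2 * σ)) * (3 * b) := by
      gcongr; linarith
    nlinarith
  linarith

/-- Adding a short segment `xy`, whose endpoints are almost equidistant from all strainer points,
to a strainer; the new strained point is the midpoint of `xy`. -/
theorem Strained.cons {X : Type*} [MetricSpace X] {k : ℕ} {δ δ₁ R ρ D : ℝ}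
    {c : Fin k → Bool → X} {w x y : X} (hδ : 0 < δ) (hδ₁ : δ₁ ≤ δ) (hR : R ≤ ρ)
    (hQ : ∀ p a b z : X, a ≠ p → b ≠ p → z ≠ p → dist p a ≤ ρ → dist p b ≤ ρ → dist p z ≤ ρ →
      vcos p a b ≤ -1 + δ₁ → -(δ / 8) ≤ vcos p z a + vcos p z b) (hδ₁0 : 0 < δ₁)
    (hw : Strained δ₁ R c w) (hx : Strained δ₁ R c x) (hy : Strained δ₁ R c y)
    (hxw : x ≠ w) (hwy : dist w y = dist w x) (hxy : dist x y = 2 * dist w x)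
    (hR' : dist w x < R) (hD : ∀ i e, D ≤ dist w (c i e) ∧ D ≤ dist x (c i e) ∧ D ≤ dist y (c i e))
    (hσ : dist w x ≤ δ / 16 * D) (hσ' : 2 * dist w x ≤ D)
    (hd : ∀ i e, |dist x (c i e) - dist y (c i e)| ≤ δ / 24 * dist x y) :
    Strained δ R (Fin.cons (fun e => bif e then x else y) c : Fin (k + 1) → Bool → X) w := by
  have h0 := dist_pos.2 hxw.symm
  have hD0 : 0 < D := by linarith
  have hyw : y ≠ w := by
    rintro rfl
    rw [dist_self] at hwy; linarith
  have hcosxy : vcos w x y = -1 := by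
    unfold vcos euclCos
    rw [hwy, hxy]; field_simp; norm_num
  have low : ∀ i e, -(δ / 8) ≤ vcos w (c i e) x + vcos w (c i e) y := fun i e =>
    hQ w x y (c i e) hxw hyw (hw.ne i e) (by linarith) (by linarith)
      ((hw.dist_lt i e).le.trans hR) (by linarith)
  have lowx : ∀ i e, -(δ / 8) ≤ vcos w x (c i e) := fun i e => by
    have := neg_le_vcos_of_abs_sub_le hxw hwy hxy (hσ'.trans (hD i e).1) (hd i e) (low i e)
    linarith
  have lowy : ∀ i e, -(δ / 8) ≤ vcos w y (c i e) := fun i e => by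
    have := neg_le_vcos_of_abs_sub_le (w := w) (x := y) (y := x) (c := c i e) (μ := δ / 8)
      (δ := δ / 24) hyw hwy.symm (by rw [dist_comm, hxy, hwy])
      (by rw [hwy]; exact hσ'.trans (hD i e).1)
      (by rw [abs_sub_comm, dist_comm y x]; exact hd i e) (by rw [add_comm]; exact low i e)
    linarith
  have sup : ∀ z, Strained δ₁ R c z → z ≠ w → dist w z = dist w x →
      (∀ i e, D ≤ dist z (c i e)) → (∀ i e, -(δ / 8) ≤ vcos w z (c i e)) →
      ∀ i e, vcos w z (c i e) < δ := fun z hz hzw hdz hDz hlow i e => by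
    have q := hQ z (c i true) (c i false) w (hz.ne i _) (hz.ne i _) hzw.symm
      ((hz.dist_lt i _).le.trans hR) ((hz.dist_lt i _).le.trans hR)
      (by rw [dist_comm, hdz]; linarith) (hz.opp i).le
    have hs : dist w z / D ≤ δ / 16 := by
      rw [hdz, div_le_iff₀ hD0]; exact hσ
    have t := vcos_add_vcos_le hzw hD0 (hD i true).1 (hDz i true)
    have f := vcos_add_vcos_le hzw hD0 (hD i false).1 (hDz i false)
    have lt := hlow i true
    have lf := hlow i false
    cases e <;> linarith
  have supx := sup x hx hxw rfl (fun i e => (hD i e).2.1) lowx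
  have supy := sup y hy hyw hwy (fun i e => (hD i e).2.2) lowy
  have new : ∀ (e : Bool) i f, vcos w (bif e then x else y) (c i f) < δ := fun e i f => by
    cases e
    · exact supy i f
    · exact supx i f
  refine ⟨fun i => ?_, fun i => ?_, fun i => ?_, fun i j => ?_⟩
  · refine Fin.cases (fun e => ?_) (fun i e => ?_) i
    · cases e
      · exact hyw
      · exact hxw
    · exact hw.ne i e
  · refine Fin.cases (fun e => ?_) (fun i e => ?_) i
    · cases e
      · exact hwy.trans_lt hR'
      · exact hR'
    · exact hw.dist_lt i e
  · refine Fin.cases ?_ (fun i => ?_) i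
    · change vcos w x y < -1 + δ
      linarith
    · exact (hw.opp i).trans_le (by linarith)
  · refine Fin.cases ?_ (fun i => ?_) i
    · refine Fin.cases (fun h => absurd rfl h) (fun j _ e f => ?_) j
      exact new e j f
    · refine Fin.cases (fun _ e f => ?_) (fun j hij e f => ?_) j
      · change vcos w (c i e) (bif f then x else y) < δ
        rw [vcos_comm]
        exact new f i e
      · exact (hw.orth i j (fun h => hij (by rw [h])) e f).trans_le hδ₁

/-- Large packings of small balls force strained points. -/
theorem HingeSpace.exists_strained {X : Type*} [MetricSpace X] {C r : ℝ} {pt : X → X → ℕ → X}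
    (H : HingeSpace X C r pt) {c : ℝ} (hc : 0 < c) (k : ℕ) : ∀ δ > 0,
    ∃ N : ℕ, ∃ R > 0, ∀ p₀ ρ₀, 0 < ρ₀ → ρ₀ ≤ R → Pack N c p₀ ρ₀ →
      ∃ p, dist p₀ p < ρ₀ ∧ ∃ a : Fin k → Bool → X, Strained δ (4 * ρ₀) a p := by
  induction k with
  | zero =>
    intro δ _
    refine ⟨0, 1, one_pos, fun p₀ ρ₀ h0 _ _ => ⟨p₀, by simpa using h0, Fin.elim0, ?_⟩⟩
    exact ⟨fun i => i.elim0, fun i => i.elim0, fun i => i.elim0, fun i => i.elim0⟩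
  | succ k ih =>
    intro δ hδ
    obtain ⟨δq, hδq, ρ, hρ, hQ⟩ := H.opposite (δ / 8) (by linarith)
    have hδ₁ : 0 < min δ δq := lt_min hδ hδq
    obtain ⟨N₁, R₁, hR₁, h₁⟩ := ih (min δ δq) hδ₁
    obtain ⟨N₂, h₂⟩ := exists_ne_forall_abs_sub_le (Fin k × Bool) (96 / (δ * c))
    refine ⟨max N₁ N₂, min R₁ (min (ρ / 4) (r / 2)),
      lt_min hR₁ (lt_min (by linarith) (by linarith [H.r_pos])), fun p₀ ρ₀ h0 hle hpack => ?_⟩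
    have hle2 := le_min_iff.1 (le_min_iff.1 hle).2
    obtain ⟨p, hp, a, ha⟩ := h₁ p₀ ρ₀ h0 (le_min_iff.1 hle).1 (hpack.mono (le_max_left _ _))
    obtain ⟨D, hD0, hD⟩ : ∃ D > 0, ∀ i e, 2 * D ≤ dist p (a i e) := by
      have : ∀ᶠ D in nhdsWithin (0 : ℝ) (Ioi 0), ∀ i e, 2 * D ≤ dist p (a i e) := by
        refine Filter.eventually_all.2 fun i => Filter.eventually_all.2 fun e => ?_
        have hpos : 0 < dist p (a i e) := dist_pos.2 (ha.ne i e).symm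
        filter_upwards [Ioo_mem_nhdsGT (half_pos hpos)] with D hD
        linarith [hD.2]
      obtain ⟨D, hD, hD'⟩ := (this.and self_mem_nhdsWithin).exists
      exact ⟨D, hD', hD⟩
    obtain ⟨η, hη, hηs⟩ := Metric.eventually_nhds_iff.1 ha.eventually
    obtain ⟨ρ', hρ', hρ'le, u, hu1, hu2⟩ := H.exists_pack (hpack.mono (le_max_right _ _)) hp
      (by linarith) (η := min (min (η / 4) ((ρ₀ - dist p₀ p) / 4)) (min (D / 4) (δ / 16 * D)))
      (lt_min (lt_min (by linarith) (by linarith)) (lt_min (by linarith) (by positivity)))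
    simp only [le_min_iff] at hρ'le
    obtain ⟨⟨l1, l2⟩, l3, l4⟩ := hρ'le
    obtain ⟨i, j, hij, hF⟩ := h₂ (fun i b => dist (u i) (a b.1 b.2) - dist p (a b.1 b.2))
      (δ / 24 * (c / 4 * ρ')) (by positivity) (fun i b => by
        have e : 96 / (δ * c) * (δ / 24 * (c / 4 * ρ')) = ρ' := by field_simp; norm_num
        rw [e, dist_comm (u i), dist_comm p]
        exact (abs_dist_sub_dist_le_dist (a b.1 b.2) (u i) p).trans
          (by rw [dist_comm]; exact (hu1 i).le))
    have hs := hu2 i j hij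
    have hxyle : dist (u i) (u j) < 2 * ρ' := by
      linarith [dist_le_dist_add_dist p (u i) (u j), hu1 i, hu1 j]
    have hs0 : 0 < dist (u i) (u j) := lt_of_lt_of_le (by positivity) hs
    have hw1 : dist (u i) (pt (u i) (u j) 1) = dist (u i) (u j) / 2 := by rw [H.dist_left]; norm_num
    have hw2 : dist (pt (u i) (u j) 1) (u j) = dist (u i) (u j) / 2 := by
      rw [H.dist_right]; ring
    set x := u i
    set y := u j
    set w := pt x y 1
    rw [dist_comm] at hw1
    have hpw : dist p w < 2 * ρ' := by
      linarith [dist_triangle p x w, hu1 i, dist_comm w x]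
    have hfar : ∀ z, dist p z < 2 * ρ' → ∀ i e, D ≤ dist z (a i e) := fun z hz i e => by
      linarith [dist_triangle p z (a i e), hD i e]
    have hstr : ∀ z, dist p z < 2 * ρ' → Strained (min δ δq) (4 * ρ₀) a z := fun z hz =>
      hηs (by rw [dist_comm]; linarith)
    have hx2 : dist p x < 2 * ρ' := by linarith [hu1 i]
    have hy2 : dist p y < 2 * ρ' := by linarith [hu1 j]
    refine ⟨w, by linarith [dist_triangle p₀ p w], _,
      Strained.cons (ρ := ρ) (x := x) (y := y) (D := D) hδ (min_le_left _ _) (by linarith)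
        (fun p a b z h1 h2 h3 h4 h5 h6 h7 => hQ p a b z h1 h2 h3 h4 h5 h6
          (h7.trans (by linarith [min_le_right δ δq])))
        hδ₁ (hstr w hpw) (hstr x hx2) (hstr y hy2) ?_ (by rw [hw1, hw2]) (by rw [hw1]; ring)
        (by linarith [dist_nonneg (x := p₀) (y := p)])
        (fun i e => ⟨hfar w hpw i e, hfar x hx2 i e, hfar y hy2 i e⟩) (by linarith)
        (by linarith) (fun m e => ?_)⟩
    · exact (dist_pos.1 (by linarith : 0 < dist w x)).symm
    · have := hF (m, e)
      simp only [sub_sub_sub_cancel_right] at this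
      exact this.trans (by gcongr)

/-! ### Strained points bound the dimension from below -/

theorem exists_eq_zero_of_descent {X : Type*} [MetricSpace X] [CompleteSpace X] {Φ : X → ℝ}
    (hΦ : Continuous Φ) (hΦ0 : ∀ w, 0 ≤ Φ w) {p : X} {θ : ℝ} (hθ : θ < 1)
    (h : ∀ w, dist p w + 2 * Φ w ≤ 2 * Φ p →
      ∃ w', dist w w' ≤ 2 * (Φ w - Φ w') ∧ Φ w' ≤ θ * Φ w) :
    ∃ w, Φ w = 0 := by
  choose! g hg1 hg2 using h
  have inv : ∀ n, dist p (g^[n] p) + 2 * Φ (g^[n] p) ≤ 2 * Φ p := by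
    intro n
    induction n with
    | zero => simp
    | succ n ih =>
      rw [Function.iterate_succ_apply']
      linarith [hg1 _ ih, dist_triangle p (g^[n] p) (g (g^[n] p))]
  by_cases hp : Φ p = 0
  · exact ⟨p, hp⟩
  have hp0 : 0 < Φ p := lt_of_le_of_ne (hΦ0 p) (Ne.symm hp)
  have hθ0 : 0 ≤ θ := by
    by_contra hθ0
    have := hg2 p (by simp)
    nlinarith [hΦ0 (g p)]
  have geo : ∀ n, Φ (g^[n] p) ≤ Φ p * θ ^ n := by
    intro n
    induction n with
    | zero => simp
    | succ n ih =>
      rw [Function.iterate_succ_apply', pow_succ]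
      nlinarith [hg2 _ (inv n)]
  have hcau : CauchySeq (fun n => g^[n] p) :=
    cauchySeq_of_le_geometric θ (2 * Φ p) hθ fun n => by
      have := hg1 _ (inv n)
      rw [Function.iterate_succ_apply']
      linarith [geo n, hΦ0 (g (g^[n] p))]
  obtain ⟨w, hw⟩ := cauchySeq_tendsto_of_complete hcau
  have h1 := (hΦ.tendsto w).comp hw
  have h2 : Filter.Tendsto (fun n => Φ p * θ ^ n) Filter.atTop (nhds (Φ p * 0)) :=
    (tendsto_pow_atTop_nhds_zero_of_lt_one hθ0 hθ).const_mul _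
  rw [mul_zero] at h2
  exact ⟨w, le_antisymm (le_of_tendsto_of_tendsto' h1 h2 geo) (hΦ0 w)⟩

theorem sub_mul_le_dist {X : Type*} [MetricSpace X] {w w' b : X} {β : ℝ} (hw' : w' ≠ w)
    (hb : b ≠ w) (hβ : |β| ≤ 1) (h : vcos w w' b ≤ β) :
    dist w b - β * dist w w' ≤ dist w' b := by
  have h1 := dist_sq_eq hw' hb
  have ht := dist_pos.2 hw'.symm
  have hD := dist_pos.2 hb.symm
  refine (abs_le_of_sq_le_sq' ?_ dist_nonneg).2
  rw [h1]
  have h2 := mul_le_mul_of_nonneg_left h (mul_pos ht hD).le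
  have h3 : β ^ 2 ≤ 1 := by rw [← sq_abs]; nlinarith [abs_nonneg β]
  nlinarith [sq_nonneg (dist w w')]

theorem dist_le_add_mul {X : Type*} [MetricSpace X] {w w' b : X} {β : ℝ} (hw' : w' ≠ w)
    (hb : b ≠ w) (hβ : 0 ≤ β) (ht' : dist w w' ≤ β * dist w b) (h : -β ≤ vcos w w' b) :
    dist w' b ≤ dist w b + 2 * β * dist w w' := by
  have h1 := dist_sq_eq hw' hb
  have ht := dist_pos.2 hw'.symm
  have hD := dist_pos.2 hb.symm
  refine (abs_le_of_sq_le_sq' ?_ (by positivity)).2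
  rw [h1]
  have h2 := mul_le_mul_of_nonneg_left h (mul_pos ht hD).le
  have h3 := mul_le_mul_of_nonneg_left ht' ht.le
  nlinarith [sq_nonneg (β * dist w w')]

theorem exists_half_le_div_two_pow {d M : ℝ} (hM : 0 < M) (hd : M ≤ d) :
    ∃ j : ℕ, M / 2 ≤ d / 2 ^ j ∧ d / 2 ^ j ≤ M := by
  obtain ⟨j, hj⟩ := exists_nat_pow_near (x := d / M) (y := 2) (by rwa [le_div_iff₀ hM, one_mul])
    one_lt_two
  refine ⟨j + 1, ?_, ?_⟩
  · rw [le_div_iff₀ (by positivity), pow_succ]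
    have := hj.1
    rw [le_div_iff₀ hM] at this
    linarith
  · rw [div_le_iff₀ (by positivity)]
    have := hj.2
    rw [div_lt_iff₀ hM] at this
    linarith

/-- Moving towards a strainer point changes the corresponding distance coordinate at almost unit
speed and the other ones almost not at all. -/
theorem HingeSpace.exists_move {X : Type*} [MetricSpace X] {C r : ℝ} {pt : X → X → ℕ → X}
    (H : HingeSpace X C r pt) {β : ℝ} (hβ : 0 < β) (hβ1 : β ≤ 1 / 2) :
    ∃ δ > 0, ∃ R > 0, ∀ {k : ℕ} (c : Fin k → Bool → X) (w : X), Strained δ R c w →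
      ∀ M, 0 < M → (∀ i e, M ≤ β * dist w (c i e)) → ∀ i (e : Bool), ∃ t ∈ Icc (M / 2) M, ∃ w',
        dist w w' = t ∧
        (∀ l, l ≠ i → |dist w' (c l true) - dist w (c l true)| ≤ 4 * β * t) ∧
        |dist w' (c i true) - (dist w (c i true) + (bif e then -t else t))| ≤ 4 * β * t := by
  obtain ⟨δ, hδ, ρ, hρ, hQ⟩ := H.opposite β hβ
  obtain ⟨R₁, hR₁, hC⟩ := exists_pos_mul_le (2 * C) (η := β / 2) (by linarith)
  refine ⟨min (β / 2) δ, lt_min (by linarith) hδ, min (min ρ r) (min R₁ 1),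
    lt_min (lt_min hρ H.r_pos) (lt_min hR₁ one_pos), fun {k} c w hw M hM hMc i e => ?_⟩
  have hwr : ∀ l f, dist w (c l f) ≤ r := fun l f =>
    (hw.dist_lt l f).le.trans ((min_le_left _ _).trans (min_le_right _ _))
  have hwρ : ∀ l f, dist w (c l f) ≤ ρ := fun l f =>
    (hw.dist_lt l f).le.trans ((min_le_left _ _).trans (min_le_left _ _))
  have hsm : ∀ l f l' f', 2 * C * (dist w (c l f) * dist w (c l' f')) ≤ β / 2 :=
    fun l f l' f' => hC _ (by positivity) (by
      calc dist w (c l f) * dist w (c l' f') ≤ R₁ * 1 := by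
            gcongr
            · exact (hw.dist_lt l f).le.trans ((min_le_right _ _).trans (min_le_left _ _))
            · exact (hw.dist_lt l' f').le.trans ((min_le_right _ _).trans (min_le_right _ _))
        _ = R₁ := mul_one _)
  have hMd : M ≤ dist w (c i e) := by nlinarith [hMc i e, dist_nonneg (x := w) (y := c i e)]
  obtain ⟨j, hj1, hj2⟩ := exists_half_le_div_two_pow hM hMd
  have ht : dist w (pt w (c i e) j) = dist w (c i e) / 2 ^ j := H.dist_left _ _ _
  have hright := H.dist_right w (c i e) j
  have hne := H.pt_ne (hw.ne i e) j
  have hpt := H.dist_pt_le w (c i e) j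
  have hH : ∀ l f, vcos w (pt w (c i e) j) (c l f) ≤ vcos w (c i e) (c l f) + β / 2 :=
    fun l f => by
      have h := H.vcos_pt_le (hw.ne i e) (hw.ne l f) (hwr i e) (hwr l f) j 0
      rw [H.pt_zero] at h
      linarith [hsm i e l f]
  refine ⟨dist w (c i e) / 2 ^ j, ⟨hj1, hj2⟩, pt w (c i e) j, ht, fun l hl => ?_, ?_⟩
  · have hup : ∀ f, vcos w (pt w (c i e) j) (c l f) ≤ β := fun f => by
      linarith [hH l f, hw.orth i l hl.symm e f, min_le_left (β / 2) δ]
    have hlow := hQ w (c l true) (c l false) _ (hw.ne _ _) (hw.ne _ _) hne (hwρ _ _) (hwρ _ _)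
      (hpt.trans (hwρ _ _)) (by linarith [hw.opp l, min_le_right (β / 2) δ])
    have h1 := sub_mul_le_dist hne (hw.ne l true) (by rw [abs_of_pos hβ]; linarith) (hup true)
    have h2 := dist_le_add_mul (β := 2 * β) hne (hw.ne l true) (by linarith)
      (by rw [ht]; linarith [hMc l true]) (by linarith [hup false])
    rw [ht] at h1 h2
    rw [abs_le]
    have : 0 < β * (dist w (c i e) / 2 ^ j) := mul_pos hβ (by linarith)
    constructor <;> linarith
  · have hpos : 0 < β * (dist w (c i e) / 2 ^ j) := mul_pos hβ (by linarith)
    cases e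
    · have h1 := sub_mul_le_dist (β := -1 + β) hne (hw.ne i true)
        (by rw [abs_le]; constructor <;> linarith)
        (by
          have := hw.opp i
          rw [vcos_comm] at this
          linarith [hH i true, min_le_left (β / 2) δ])
      have h2 := dist_triangle (pt w (c i false) j) w (c i true)
      rw [dist_comm _ w] at h2
      rw [ht] at h1 h2
      rw [abs_le]
      simp only [cond_false]
      constructor <;> linarith
    · rw [hright]
      simp only [cond_true]
      have e : (1 - 1 / 2 ^ j) * dist w (c i true) -
        (dist w (c i true) + -(dist w (c i true) / 2 ^ j)) = 0 := by ring
      rw [e, abs_zero]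
      linarith

theorem HingeSpace.le_dimH_of_strained {X : Type*} [MetricSpace X] [CompleteSpace X] {C r : ℝ}
    {pt : X → X → ℕ → X} (H : HingeSpace X C r pt) (k : ℕ) (hk : 0 < k) :
    ∃ δ > 0, ∃ R > 0, ∀ (c : Fin k → Bool → X) (p : X), Strained δ R c p →
      (k : ℝ≥0∞) ≤ dimH (univ : Set X) := by
  have hk' : (1 : ℝ) ≤ k := by exact_mod_cast hk
  set β : ℝ := 1 / (8 * k) with hβdef
  have hβ : 0 < β := by positivity
  have hkβ : k * (4 * β) = 1 / 2 := by rw [hβdef]; field_simp; norm_num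
  have hβ1 : β ≤ 1 / 2 := by nlinarith
  obtain ⟨δ, hδ, R, hR, hmove⟩ := H.exists_move hβ hβ1
  refine ⟨δ, hδ, R, hR, fun c p hp => ?_⟩
  obtain ⟨η, hη, hηs⟩ := Metric.eventually_nhds_iff.1 hp.eventually
  have hD : ∀ᶠ D in nhdsWithin (0 : ℝ) (Ioi 0), ∀ i e, D ≤ β * (dist p (c i e) - 2 * D) := by
    refine Filter.eventually_all.2 fun i => Filter.eventually_all.2 fun e => ?_
    have hpos : 0 < dist p (c i e) := dist_pos.2 (hp.ne i e).symm
    have h0 : 0 < β * dist p (c i e) / 2 := by positivity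
    filter_upwards [Ioo_mem_nhdsGT h0] with D hD
    nlinarith [hD.1, hD.2]
  obtain ⟨D, hD, hD0 : 0 < D⟩ := (hD.and self_mem_nhdsWithin).exists
  set f : X → Fin k → ℝ := fun w l => dist w (c l true) with hf
  have hlip : LipschitzWith 1 f := by
    refine LipschitzWith.of_dist_le_mul fun x y => ?_
    rw [NNReal.coe_one, one_mul, dist_pi_le_iff dist_nonneg]
    intro l
    change |dist x (c l true) - dist y (c l true)| ≤ dist x y
    rw [dist_comm x (c l true), dist_comm y (c l true)]
    exact abs_dist_sub_dist_le_dist (c l true) x y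
  have hsurj : ∀ v : Fin k → ℝ, 2 * ∑ l, |v l - f p l| < min η D → v ∈ range f := by
    intro v hv
    have hcont : Continuous fun w => ∑ l, |v l - f w l| := by
      refine continuous_finsetSum _ fun l _ => ?_
      have : Continuous fun w => f w l := by simp only [hf]; fun_prop
      fun_prop
    set Φ : X → ℝ := fun w => ∑ l, |v l - f w l| with hΦ
    have hstep : ∀ w, dist p w + 2 * Φ w ≤ 2 * Φ p →
        ∃ w', dist w w' ≤ 2 * (Φ w - Φ w') ∧ Φ w' ≤ (1 - 1 / (4 * k)) * Φ w := by
      intro w hw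
      have hne : (Finset.univ : Finset (Fin k)).Nonempty := ⟨⟨0, hk⟩, Finset.mem_univ _⟩
      obtain ⟨i, -, hi⟩ := Finset.exists_max_image Finset.univ (fun l => |v l - f w l|) hne
      set M := |v i - f w i| with hM
      have hΦM : Φ w ≤ k * M := by
        calc Φ w ≤ ∑ _l : Fin k, M := Finset.sum_le_sum fun l _ => hi l (Finset.mem_univ _)
          _ = k * M := by simp
      have hMΦ : M ≤ Φ w :=
        Finset.single_le_sum (f := fun l => |v l - f w l|) (fun l _ => abs_nonneg _)
          (Finset.mem_univ i)
      have hΦ0 : 0 ≤ Φ w := Finset.sum_nonneg fun l _ => abs_nonneg _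
      rcases eq_or_lt_of_le (abs_nonneg (v i - f w i)) with h0 | h0
      · have hz : Φ w = 0 := le_antisymm (by rw [hM, ← h0, mul_zero] at hΦM; exact hΦM) hΦ0
        exact ⟨w, by simp, by rw [hz, mul_zero]⟩
      have hpη : dist p w < η := by linarith [min_le_left η D]
      have hpD : dist p w < D := by linarith [min_le_right η D]
      have hstr : Strained δ R c w := hηs (by rwa [dist_comm])
      have hMc : ∀ l e, M ≤ β * dist w (c l e) := fun l e => by
        refine le_trans (b := D) (by linarith [min_le_right η D, dist_nonneg (x := p) (y := w)]) ?_
        refine (hD l e).trans ?_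
        gcongr
        linarith [dist_triangle p w (c l e)]
      obtain ⟨t, ht, w', hw', hoth, hself⟩ :=
        hmove c w hstr M h0 hMc i (decide (v i ≤ f w i))
      have hself' : |v i - f w' i| ≤ M - t + 4 * β * t := by
        have hself2 := abs_le.1 hself
        have htM := ht.2
        change -(4 * β * t) ≤ f w' i - (f w i + _) ∧ f w' i - (f w i + _) ≤ 4 * β * t at hself2
        by_cases hle : v i ≤ f w i
        · simp only [hle, decide_true, cond_true] at hself2
          have hMe : M = f w i - v i := by rw [hM, abs_of_nonpos (by linarith)]; ring
          rw [abs_le]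
          constructor <;> linarith
        · simp only [hle, decide_false, cond_false] at hself2
          have hMe : M = v i - f w i := by rw [hM, abs_of_nonneg (by linarith)]
          rw [abs_le]
          constructor <;> linarith
      have hΦw' : Φ w' ≤ Φ w - t / 2 := by
        have hle : ∀ l, |v l - f w' l| ≤ |v l - f w l| + 4 * β * t - (if l = i then t else 0) := by
          intro l
          by_cases hl : l = i
          · subst hl
            simp only [if_true]
            linarith
          · simp only [hl, if_false, sub_zero]
            have h1 := hoth l hl
            have h2 := abs_sub_le (v l) (f w l) (f w' l)
            rw [abs_sub_comm (f w l)] at h2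
            exact h2.trans (by gcongr)
        calc Φ w' ≤ ∑ l, (|v l - f w l| + 4 * β * t - (if l = i then t else 0)) :=
              Finset.sum_le_sum fun l _ => hle l
          _ = Φ w + k * (4 * β) * t - t := by
              rw [Finset.sum_sub_distrib, Finset.sum_add_distrib]
              simp [hΦ]
              ring
          _ = Φ w - t / 2 := by rw [hkβ]; ring
      refine ⟨w', by rw [hw']; linarith, hΦw'.trans ?_⟩
      have h3 : Φ w / (4 * k) ≤ M / 4 := by
        rw [div_le_div_iff₀ (by positivity) (by positivity)]
        linarith
      have h4 : (1 - 1 / (4 * k)) * Φ w = Φ w - Φ w / (4 * k) := by ring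
      linarith [ht.1]
    have hθ : (1 : ℝ) - 1 / (4 * k) < 1 := sub_lt_self _ (by positivity)
    obtain ⟨w, hw⟩ := exists_eq_zero_of_descent hcont
      (fun w => Finset.sum_nonneg fun l _ => abs_nonneg _) hθ hstep
    refine ⟨w, funext fun l => ?_⟩
    have := (Finset.sum_eq_zero_iff_of_nonneg fun l _ => abs_nonneg _).1 hw l (Finset.mem_univ _)
    linarith [abs_eq_zero.1 this]
  have hnhds : range f ∈ nhds (f p) := by
    have hc : ContinuousAt (fun v : Fin k → ℝ => 2 * ∑ l, |v l - f p l|) (f p) :=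
      (continuous_const.mul (continuous_finsetSum _ fun l _ => by fun_prop)).continuousAt
    have := hc.tendsto.eventually_lt_const (u := min η D) (by simpa using ⟨hη, hD0⟩)
    exact Filter.mem_of_superset this fun v hv => hsurj v hv
  have h1 := Real.dimH_of_mem_nhds hnhds
  rw [Module.finrank_fin_fun] at h1
  rw [← h1]
  exact hlip.dimH_range_le

/-- A uniform bound on the size of packings of small balls. -/
theorem HingeSpace.exists_not_pack {X : Type*} [MetricSpace X] [CompleteSpace X] {C r : ℝ}
    {pt : X → X → ℕ → X} (H : HingeSpace X C r pt) {n : ℕ} (hn : dimH (univ : Set X) = n) {c : ℝ}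
    (hc : 0 < c) : ∃ N : ℕ, ∃ R > 0, ∀ (p : X) (ρ : ℝ), 0 < ρ → ρ ≤ R → ¬ Pack N c p ρ := by
  obtain ⟨δ, hδ, R, hR, h1⟩ := H.le_dimH_of_strained (n + 1) n.succ_pos
  obtain ⟨N, R', hR', h2⟩ := H.exists_strained hc (n + 1) δ hδ
  refine ⟨N, min R' (R / 4), lt_min hR' (by linarith), fun p ρ hρ hle hpack => ?_⟩
  obtain ⟨q, -, a, ha⟩ := h2 p ρ hρ (hle.trans (min_le_left _ _)) hpack
  have h3 := h1 a q (ha.mono le_rfl (by linarith [min_le_right R' (R / 4)]))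
  rw [hn] at h3
  have : n + 1 ≤ n := by exact_mod_cast h3
  omega

theorem HingeSpace.isCompact_closedBall {X : Type*} [MetricSpace X] [CompleteSpace X] {C r : ℝ}
    {pt : X → X → ℕ → X} (H : HingeSpace X C r pt) {n : ℕ} (hn : dimH (univ : Set X) = n)
    (p : X) : IsCompact (closedBall p (r / 4)) := by
  have hr := H.r_pos
  refine TotallyBounded.isCompact_of_isClosed ?_ isClosed_closedBall
  rw [Metric.totallyBounded_iff]
  by_contra! hcon
  obtain ⟨ε, hε, hcov⟩ := hcon
  obtain ⟨f, hf, hsep⟩ := exists_seq_of_forall_finset_exists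
    (fun x => x ∈ closedBall p (r / 4)) (fun x y => ε ≤ dist x y) (fun s _ => by
      obtain ⟨y, hy, hys⟩ := Set.not_subset.1 (hcov s s.finite_toSet)
      refine ⟨y, hy, fun x hx => ?_⟩
      by_contra! hlt
      exact hys (Set.mem_biUnion (Finset.mem_coe.2 hx) (by rwa [mem_ball, dist_comm])))
  have hc : 0 < ε / (r / 2) := by positivity
  obtain ⟨N, R, hR, hnot⟩ := H.exists_not_pack hn (c := ε / (r / 2) / 4) (by positivity)
  have hpack : Pack N (ε / (r / 2)) p (r / 2) := by
    refine ⟨fun i => f i, fun i => ?_, fun i j hij => ?_⟩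
    · have := mem_closedBall'.1 (hf i)
      linarith
    · rw [div_mul_cancel₀ _ (by positivity)]
      rcases lt_or_gt_of_ne hij with h | h
      · exact hsep _ _ h
      · rw [dist_comm]
        exact hsep _ _ h
  obtain ⟨ρ', hρ', hle, hp⟩ := H.exists_pack hpack (w := p) (by simpa using hr) (by linarith) hR
  exact hnot p ρ' hρ' hle hp

/-- If a point `v` cannot be almost extended away from `x`, then it is seen from `x` under a definite
angle with respect to any point much farther away. -/
theorem HingeSpace.mul_le_dist_pt {X : Type*} [MetricSpace X] {C r : ℝ} {pt : X → X → ℕ → X}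
    (H : HingeSpace X C r pt) {x u v : X} {ε M : ℝ} {i j : ℕ} (hε : 0 < ε) (hε1 : ε ≤ 1)
    (hvx : v ≠ x) (hvu : 4 * dist x v ≤ dist x u) (hur : dist x u ≤ r)
    (hv : ∀ z, dist x v ≤ dist v z → dist v z ≤ 5 * dist x v →
      dist x z < dist x v + dist v z - ε * dist x v)
    (hM : 0 < M) (hMv : M ≤ dist x v) (hi : M / 2 ≤ dist x u / 2 ^ i) (hi' : dist x u / 2 ^ i ≤ M)
    (hj : M / 2 ≤ dist x v / 2 ^ j) : ε / 4 * M ≤ dist (pt x u i) (pt x v j) := by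
  have hl : 0 < dist x v := dist_pos.2 hvx.symm
  set l := dist x v with hldef
  have hux : u ≠ x := by
    rintro rfl
    rw [dist_self] at hvu
    linarith
  obtain ⟨k, hk1, hk2⟩ := exists_half_le_div_two_pow (M := 4 * l) (by linarith) hvu
  set z := pt x u k with hz
  have hzx : z ≠ x := H.pt_ne hux k
  have hs : dist x z = dist x u / 2 ^ k := H.dist_left x u k
  rw [← hs] at hk1 hk2
  set s := dist x z with hsdef
  have hcos : ε / 2 ≤ 1 - vcos x z v := by
    have h1 := dist_triangle x v z
    have h2 := dist_triangle v x z
    rw [dist_comm v x] at h2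
    have h3 := hv z (by linarith) (by linarith)
    have h4 := dist_sq_eq hzx hvx
    rw [dist_comm z v] at h4
    have h5 : (s - l + ε * l) ^ 2 ≤ dist v z ^ 2 := by
      have : 0 ≤ ε * l := by positivity
      exact pow_le_pow_left₀ (by linarith) (by linarith) 2
    have h6 : 2 * (s - l) * (ε * l) ≤ 2 * s * l * (1 - vcos x z v) := by
      nlinarith [sq_nonneg (ε * l)]
    have h7 : 2 * (s - l) * ε ≤ 2 * s * (1 - vcos x z v) :=
      le_of_mul_le_mul_right (by linarith) hl
    have h8 : s * ε ≤ s * (2 * (1 - vcos x z v)) := by nlinarith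
    have := le_of_mul_le_mul_left h8 (by linarith)
    linarith
  have hki : k ≤ i := by
    by_contra! hlt
    have : dist x u / 2 ^ k ≤ dist x u / 2 ^ i / 2 := by
      rw [div_div, ← pow_succ]
      exact div_le_div_of_nonneg_left dist_nonneg (by positivity)
        (pow_le_pow_right₀ one_le_two hlt)
    rw [← hs] at this
    linarith
  have hw : pt x u i = pt x z (i - k) := by rw [hz, H.pt_pt, Nat.sub_add_cancel hki]
  have hsr : s ≤ r := by linarith
  have hlr : l ≤ r := by linarith
  have h1 := H.hinge x z v (i - k) j hzx hvx hsr hlr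
  have h2 := H.mul_mul_le hsr hl.le hlr
  rw [← hw] at h1
  have h3 : ε / 4 ≤ 1 - vcos x (pt x u i) (pt x v j) := by
    refine le_trans ?_ h1
    change ε / 4 ≤ (1 - vcos x z v) * (1 - C * (s * l))
    nlinarith
  have h4 := dist_sq_eq (H.pt_ne hux i) (H.pt_ne hvx j)
  rw [H.dist_left, H.dist_left] at h4
  set a := dist x u / 2 ^ i
  set b := dist x v / 2 ^ j
  refine abs_le_of_sq_le_sq' ?_ dist_nonneg |>.2
  have h5 : M / 2 * (M / 2) ≤ a * b := by gcongr
  have h6 : M / 2 * (M / 2) * (ε / 4) ≤ a * b * (1 - vcos x (pt x u i) (pt x v j)) := by gcongr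
  have h7 : ε * ε ≤ ε := by nlinarith
  have h8 : M ^ 2 * (ε * ε) ≤ M ^ 2 * ε := by gcongr
  nlinarith [sq_nonneg (a - b)]

/-- Geodesics from a given point `x` can be almost extended at small scales. -/
theorem HingeSpace.exists_almost_extension {X : Type*} [MetricSpace X] [CompleteSpace X] {C r : ℝ}
    {pt : X → X → ℕ → X} (H : HingeSpace X C r pt) {n : ℕ} (hn : dimH (univ : Set X) = n) (x : X)
    {ε : ℝ} (hε : 0 < ε) (hε1 : ε ≤ 1) :
    ∃ R > 0, ∀ v, v ≠ x → dist x v < R → ∃ z, dist x v ≤ dist v z ∧ dist v z ≤ 5 * dist x v ∧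
      dist x v + dist v z - ε * dist x v ≤ dist x z := by
  by_contra! hcon
  obtain ⟨N, R, hR, hnot⟩ := H.exists_not_pack hn (c := ε / 8) (by positivity)
  have hr := H.r_pos
  obtain ⟨y, hy, hyy⟩ := exists_seq_of_forall_finset_exists
    (fun v => v ≠ x ∧ dist x v ≤ min r (R / 2) ∧ ∀ z, dist x v ≤ dist v z →
      dist v z ≤ 5 * dist x v → dist x z < dist x v + dist v z - ε * dist x v)
    (fun u v => 4 * dist x v ≤ dist x u) (fun s hs => by
      have h : ∀ᶠ t in nhdsWithin (0 : ℝ) (Ioi 0), ∀ u ∈ s, 4 * t < dist x u := by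
        refine (Filter.eventually_all_finset s).2 fun u hu => ?_
        have hpos : 0 < dist x u / 4 := by
          have := dist_pos.2 (hs u hu).1.symm
          positivity
        filter_upwards [Ioo_mem_nhdsGT hpos] with t ht
        linarith [ht.2]
      obtain ⟨t, ht, ht0 : 0 < t⟩ := (h.and self_mem_nhdsWithin).exists
      obtain ⟨v, hvx, hvt, hv⟩ := hcon (min t (min r (R / 2)))
        (lt_min ht0 (lt_min hr (by linarith)))
      refine ⟨v, ⟨hvx, (hvt.trans_le (min_le_right _ _)).le, hv⟩, fun u hu => ?_⟩
      linarith [ht u hu, hvt.trans_le (min_le_left _ _)])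
  set M := dist x (y N) with hMdef
  have hM : 0 < M := dist_pos.2 (hy N).1.symm
  have hMk : ∀ k < N, M ≤ dist x (y k) := fun k hk => by
    linarith [hyy k N hk]
  have hidx : ∀ k : Fin N, ∃ i : ℕ, M / 2 ≤ dist x (y k) / 2 ^ i ∧ dist x (y k) / 2 ^ i ≤ M :=
    fun k => exists_half_le_div_two_pow hM (hMk k k.2)
  choose i hi1 hi2 using hidx
  have hsep : ∀ j k : Fin N, j < k →
      ε / 8 * (2 * M) ≤ dist (pt x (y j) (i j)) (pt x (y k) (i k)) := fun j k hjk => by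
    have := H.mul_le_dist_pt hε hε1 (hy k).1 (hyy j k hjk) ((hy j).2.1.trans (min_le_left _ _))
      (hy k).2.2 hM (hMk k k.2) (hi1 j) (hi2 j) (hi1 k)
    linarith
  refine hnot x (2 * M) (by linarith)
    (by linarith [(hy N).2.1.trans (min_le_right _ _)]) ⟨fun k => pt x (y k) (i k), fun k => ?_,
      fun j k hjk => ?_⟩
  · rw [H.dist_left]
    linarith [hi2 k]
  · rcases lt_or_gt_of_ne hjk with h | h
    · exact hsep j k h
    · rw [dist_comm]
      exact hsep k j h

/-- A weak form of extremality: nearest points of `E` are critical. -/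
def NearestCritical {X : Type*} [MetricSpace X] (C r : ℝ) (E : Set X) : Prop :=
  ∀ q ∉ E, ∀ p ∈ E, infDist q E = dist q p → ∀ z, z ≠ p → dist p q ≤ r → dist p z ≤ r →
    -(C * (dist p q * dist p z)) ≤ vcos p q z

theorem IsExtremal.nearestCritical {X : Type*} [MetricSpace X] {κ r : ℝ} {E : Set X}
    (hE : IsExtremal κ E) (hr : √|κ| * r ≤ 1 / 16) : NearestCritical (40 * |κ|) r E := by
  intro q hq p hp hqp z hz hpq hpz
  have hk := Real.sqrt_nonneg |κ|
  have hqp' : q ≠ p := fun h => hq (h ▸ hp)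
  have hmin : IsLocalMinOn (fun x => dist q x) E p := by
    refine IsMinOn.localize fun e he => ?_
    change dist q p ≤ dist q e
    rw [← hqp]
    exact infDist_le_dist_of_mem he
  have h8 : ∀ t, t ≤ r → √|κ| * t ≤ 1 / 8 := fun t ht => by
    have : √|κ| * t ≤ √|κ| * r := by gcongr
    linarith
  exact neg_le_vcos_of_cangle_le hqp' hz (h8 _ hpq) (h8 _ hpz) (hE.2 q hq p hp hmin z hz)

theorem vcos_le_of_almost_extension {X : Type*} [MetricSpace X] {q x z : X} {l ε : ℝ} (hl : 0 < l)
    (hε : 0 ≤ ε) (hε1 : ε ≤ 1) (hx : l / 2 ≤ dist q x) (hz : l / 2 ≤ dist q z)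
    (h : dist q x + dist q z - ε * l ≤ dist x z) : vcos q x z ≤ -1 + 4 * ε := by
  have hxq : x ≠ q := (dist_pos.1 (by linarith : 0 < dist q x)).symm
  have hzq : z ≠ q := (dist_pos.1 (by linarith : 0 < dist q z)).symm
  have h1 := dist_sq_eq hxq hzq
  set a := dist q x
  set b := dist q z
  have h2 : (a + b - ε * l) ^ 2 ≤ dist x z ^ 2 := by
    have : ε * l ≤ 1 * l := by gcongr
    exact pow_le_pow_left₀ (by linarith) h 2
  have h3 : 2 * (a * b) * (1 + vcos q x z) ≤ 2 * (a + b) * (ε * l) := by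
    nlinarith [sq_nonneg (ε * l)]
  have hab : (a + b) * l ≤ 4 * (a * b) := by nlinarith
  have h4 : ε * ((a + b) * l) ≤ ε * (4 * (a * b)) := by gcongr
  have hab0 : 0 < a * b := mul_pos (by linarith) (by linarith)
  have h5 : a * b * (1 + vcos q x z) ≤ a * b * (4 * ε) := by linarith
  have := le_of_mul_le_mul_left h5 hab0
  linarith

/-- Moving `q` towards `x` increases the distance to `E` in a controlled way. -/
theorem HingeSpace.infDist_pt_sq_le {X : Type*} [MetricSpace X] {C r : ℝ} {pt : X → X → ℕ → X}
    (H : HingeSpace X C r pt) {E : Set X} (hE : NearestCritical C r E) {μ δ ρ l : ℝ}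
    (hμ : μ ≤ 1) (hδ : 0 < δ) (hδ1 : δ ≤ 8)
    (hopp : ∀ p a b x : X, a ≠ p → b ≠ p → x ≠ p → dist p a ≤ ρ → dist p b ≤ ρ → dist p x ≤ ρ →
      vcos p a b ≤ -1 + δ → -μ ≤ vcos p x a + vcos p x b)
    (hl : 0 < l) (hlr : 7 * l ≤ r) (hlρ : 7 * l ≤ ρ) (hlδ : 12 * C * l ^ 2 ≤ δ / 2) {q x z p : X}
    (hp : p ∈ E) (hqp : infDist q E = dist q p)
    (hx : l / 2 ≤ dist q x) (hx' : dist q x ≤ l) (hz : l / 2 ≤ dist q z) (hz' : dist q z ≤ 6 * l)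
    (hxz : dist q x + dist q z - δ / 8 * l ≤ dist x z) (hq : 4 * infDist q E ≤ μ * l) (j : ℕ) :
    infDist (pt q x j) E ^ 2 ≤ infDist q E ^ 2 + (dist q x / 2 ^ j) ^ 2 +
      4 * μ * (infDist q E * (dist q x / 2 ^ j)) := by
  have hxq : x ≠ q := (dist_pos.1 (by linarith : 0 < dist q x)).symm
  have hzq : z ≠ q := (dist_pos.1 (by linarith : 0 < dist q z)).symm
  have hle : infDist (pt q x j) E ≤ dist p (pt q x j) := by
    rw [dist_comm]
    exact infDist_le_dist_of_mem hp
  have hle2 : infDist (pt q x j) E ^ 2 ≤ dist p (pt q x j) ^ 2 :=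
    pow_le_pow_left₀ infDist_nonneg hle 2
  refine hle2.trans ?_
  rw [hqp] at hq ⊢
  by_cases hqE : q ∈ E
  · have h0 : dist q p = 0 := by rw [← hqp, infDist_zero_of_mem hqE]
    rw [h0, ← dist_eq_zero.1 h0, H.dist_left]
    simp
  have hpq : p ≠ q := fun h => hqE (h ▸ hp)
  have hg : 0 < dist q p := dist_pos.2 hpq.symm
  have h1 := vcos_le_of_almost_extension hl (by linarith) (by linarith) hx hz hxz
  have h2 := H.vcos_pt_le hxq hzq (by linarith) (by linarith) j 0
  rw [H.pt_zero] at h2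
  have hC := H.C_nonneg
  have h3 : 2 * C * (dist q x * dist q z) ≤ 2 * C * (l * (6 * l)) := by gcongr
  have hdt : dist q (pt q x j) ≤ dist q x := H.dist_pt_le q x j
  have hμl : μ * l ≤ 1 * l := by gcongr
  have h4 := hopp q (pt q x j) z p (H.pt_ne hxq j) hzq hpq (by linarith) (by linarith)
    (by linarith) (by nlinarith)
  have hpz : z ≠ p := by
    rintro rfl
    linarith
  have hpz' : dist p z ≤ r := by
    linarith [dist_triangle p q z, dist_comm p q]
  have h5 := hE q hqE p hp hqp z hpz (by rw [dist_comm]; linarith) hpz'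
  have h6 := dist_sq_eq hpq.symm hpz
  have h7 := dist_sq_eq hpq hzq
  have h8 : C * (dist p z * dist p z) ≤ 1 / 2 := H.mul_mul_le hpz' dist_nonneg hpz'
  have h9 := dist_sq_eq hpq (H.pt_ne hxq j)
  rw [dist_comm p q] at h5 h6
  rw [H.dist_left] at h9
  have ht : 0 ≤ dist q x / 2 ^ j := by positivity
  set g := dist q p
  set b := dist q z
  set D := dist p z
  set t := dist q x / 2 ^ j
  have hD : 0 < D := dist_pos.2 hpz.symm
  have h10 : vcos q p z ≤ μ := by
    have e1 : 2 * (g * D) * -(C * (g * D)) ≤ 2 * (g * D) * vcos p q z := by gcongr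
    have e2 : g * g * (C * (D * D)) ≤ g * g * (1 / 2) := by gcongr
    have e3 : 2 * g * (b * vcos q p z) ≤ 2 * g * (3 / 2 * g) := by nlinarith
    have e4 := le_of_mul_le_mul_left e3 (by linarith)
    by_contra! hlt
    have hμ0 : 0 < μ := by nlinarith
    have : l / 2 * μ < b * vcos q p z := by
      calc l / 2 * μ < l / 2 * vcos q p z := by gcongr
        _ ≤ b * vcos q p z := by
          have := hμ0.trans hlt
          gcongr
    linarith
  have h11 : g * t * -(2 * μ) ≤ g * t * vcos q p (pt q x j) := by
    gcongr
    linarith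
  linarith

theorem exists_infDist_eq_dist_of_isCompact {X : Type*} [MetricSpace X] {E : Set X}
    (hE : IsClosed E) {q y : X} {s : ℝ} (hc : IsCompact (closedBall q s)) (hy : y ∈ E)
    (hqy : dist q y ≤ s) : ∃ p ∈ E, infDist q E = dist q p := by
  have hmem : y ∈ closedBall q s ∩ E := ⟨by rwa [mem_closedBall'], hy⟩
  obtain ⟨p, hp, hmin⟩ := (hc.inter_right hE).exists_isMinOn ⟨y, hmem⟩
    (continuous_const.dist continuous_id : Continuous fun e => dist q e).continuousOn
  refine ⟨p, hp.2, le_antisymm (infDist_le_dist_of_mem hp.2) ?_⟩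
  refine (le_infDist ⟨y, hy⟩).2 fun e he => ?_
  by_cases hes : dist q e ≤ s
  · exact hmin ⟨by rwa [mem_closedBall'], he⟩
  · have h1 : dist q p ≤ dist q y := hmin hmem
    linarith

set_option maxHeartbeats 1000000 in
/-- From a point `y` of an extremal set near `x` one can make a small step inside the set which
decreases the distance to `x` almost at unit speed. -/
theorem HingeSpace.exists_step {X : Type*} [MetricSpace X] [CompleteSpace X] {C r : ℝ}
    {pt : X → X → ℕ → X} (H : HingeSpace X C r pt) {n : ℕ} (hn : dimH (univ : Set X) = n)
    {E : Set X} (hE : NearestCritical C r E) (hEc : IsClosed E) (x : X) {ε : ℝ} (hε : 0 < ε)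
    (hε1 : ε ≤ 1) :
    ∃ R > 0, ∀ σ > 0, ∃ θ, 0 < θ ∧ θ < 1 ∧ ∀ y ∈ E, y ≠ x → dist x y < R → ∃ y' ∈ E,
      dist y y' ≤ σ ∧ dist y y' ≤ (1 + ε) * (dist x y - dist x y') ∧
      dist x y' ≤ (1 - θ) * dist x y := by
  set μ : ℝ := ε ^ 2 / 512 with hμdef
  have hμ : 0 < μ := by positivity
  have hμ1 : μ ≤ 1 := by
    have : ε ^ 2 ≤ 1 := pow_le_one₀ hε.le hε1
    linarith
  obtain ⟨δ', hδ', ρ, hρ, hopp'⟩ := H.opposite μ hμ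
  obtain ⟨δ, hδ, hδ8, hopp⟩ : ∃ δ > 0, δ ≤ 8 ∧ ∀ p a b x : X, a ≠ p → b ≠ p → x ≠ p →
      dist p a ≤ ρ → dist p b ≤ ρ → dist p x ≤ ρ → vcos p a b ≤ -1 + δ →
      -μ ≤ vcos p x a + vcos p x b :=
    ⟨min δ' 8, lt_min hδ' (by norm_num), min_le_right _ _,
      fun p a b x ha hb hx h1 h2 h3 h4 => hopp' p a b x ha hb hx h1 h2 h3
        (h4.trans (by linarith [min_le_left δ' 8]))⟩
  obtain ⟨R₁, hR₁, hext⟩ := H.exists_almost_extension hn x (ε := δ / 8) (by positivity) (by linarith)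
  obtain ⟨R₂, hR₂, hsq⟩ := exists_pos_mul_le (12 * C) (η := δ / 2) (by positivity)
  have hr := H.r_pos
  obtain ⟨R, hR, hRR₁, hRR₂, hR1, hRr, hRρ⟩ : ∃ R > 0, R ≤ R₁ ∧ R ≤ R₂ ∧ R ≤ 1 ∧ 28 * R ≤ r ∧
      7 * R ≤ ρ := by
    refine ⟨min R₁ (min R₂ (min 1 (min (r / 28) (ρ / 7)))), by positivity, min_le_left _ _, ?_⟩
    set s := min R₂ (min 1 (min (r / 28) (ρ / 7))) with hs
    have h1 : min R₁ s ≤ s := min_le_right _ _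
    have h2 := min_le_left R₂ (min 1 (min (r / 28) (ρ / 7)))
    have h3 := min_le_right R₂ (min 1 (min (r / 28) (ρ / 7)))
    have h4 := min_le_left 1 (min (r / 28) (ρ / 7))
    have h5 := min_le_right 1 (min (r / 28) (ρ / 7))
    have h6 := min_le_left (r / 28) (ρ / 7)
    have h7 := min_le_right (r / 28) (ρ / 7)
    refine ⟨?_, ?_, ?_, ?_⟩ <;> linarith
  refine ⟨R, hR, fun σ hσ => ?_⟩
  obtain ⟨N, hN⟩ := exists_nat_ge (128 / ε ^ 2)
  have hN' : 128 ≤ N * ε ^ 2 := by rwa [div_le_iff₀ (by positivity)] at hN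
  have hN0 : (0 : ℝ) < N := by
    by_contra! h
    nlinarith [sq_nonneg ε]
  obtain ⟨j, hj⟩ := exists_div_two_pow_le (a := (N : ℝ)) (b := min (μ / 4) (σ / (2 * R)))
    (by positivity)
  set τ : ℝ := 1 / 2 ^ j with hτdef
  have hτ : 0 < τ := by positivity
  have hNτ : N * τ ≤ μ / 4 := by
    rw [hτdef, mul_one_div]
    exact hj.trans (min_le_left _ _)
  have hNτσ : N * τ * (2 * R) ≤ σ := by
    rw [← le_div_iff₀ (by positivity), hτdef, mul_one_div]
    exact hj.trans (min_le_right _ _)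
  refine ⟨N * τ / 4, by positivity, by linarith, fun y hy hyx hyR => ?_⟩
  have hl : 0 < dist x y := dist_pos.2 hyx.symm
  obtain ⟨z, hz1, hz2, hz3⟩ := hext y hyx (by linarith)
  set l := dist x y with hldef
  have hlδ : 12 * C * l ^ 2 ≤ δ / 2 := hsq _ (by positivity) (by nlinarith)
  let q : ℕ → X := fun i => (fun w => pt w x j)^[i] y
  have hq0 : q 0 = y := rfl
  have hqs : ∀ i, q (i + 1) = pt (q i) x j := fun i => Function.iterate_succ_apply' _ i y
  have hA : ∀ i, dist (q (i + 1)) x = dist (q i) x - τ * dist (q i) x := fun i => by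
    rw [hqs, H.dist_right]
    ring
  have hstep : ∀ i, dist (q i) (q (i + 1)) = τ * dist (q i) x := fun i => by
    rw [hqs, H.dist_left]
    ring
  have hAle : ∀ i, dist (q i) x ≤ l := by
    intro i
    induction i with
    | zero => rw [hq0, dist_comm]
    | succ i ih =>
      have : 0 ≤ τ * dist (q i) x := by positivity
      rw [hA]
      linarith
  have hAge : ∀ i : ℕ, l - i * τ * l ≤ dist (q i) x := by
    intro i
    induction i with
    | zero => rw [hq0, dist_comm]; simp [hldef]
    | succ i ih =>
      have : τ * dist (q i) x ≤ τ * l := by gcongr; exact hAle i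
      rw [hA]
      push_cast
      linarith
  have hNi : ∀ i ≤ N, (i : ℝ) * τ * l ≤ N * τ * l := fun i hi => by gcongr
  have hNl : N * τ * l ≤ μ / 4 * l := by gcongr
  have hμl : μ * l ≤ 1 * l := by gcongr
  have hAhalf : ∀ i ≤ N, l / 2 ≤ dist (q i) x := fun i hi => by
    linarith [hAge i, hNi i hi]
  have hT : ∀ i ≤ N, dist (q i) x ≤ l - i * τ * l / 2 := by
    intro i
    induction i with
    | zero => intro _; rw [hq0, dist_comm]; simp [hldef]
    | succ i ih =>
      intro hi
      have h1 := ih (by omega)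
      have h2 : τ * (l / 2) ≤ τ * dist (q i) x := by
        gcongr
        exact hAhalf i (by omega)
      rw [hA]
      push_cast
      linarith
  have hB : ∀ i, dist y (q i) ≤ l - dist (q i) x := by
    intro i
    induction i with
    | zero => rw [hq0, dist_comm y x, dist_self]; simp [hldef]
    | succ i ih =>
      rw [hA]
      linarith [dist_triangle y (q i) (q (i + 1)), hstep i]
  have hG : ∀ i, infDist (q i) E ≤ l - dist (q i) x := fun i =>
    (infDist_le_dist_of_mem hy).trans (by rw [dist_comm]; exact hB i)
  have hnear : ∀ i ≤ N, ∃ p ∈ E, infDist (q i) E = dist (q i) p := fun i hi =>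
    exists_infDist_eq_dist_of_isCompact hEc (H.isCompact_closedBall hn (q i)) hy (by
      rw [dist_comm]
      linarith [hB i, hAge i, hNi i hi])
  have hGsq : ∀ i ≤ N, infDist (q i) E ^ 2 ≤ i * ((τ * l) ^ 2 * (1 + 4 * μ * N)) := by
    intro i
    induction i with
    | zero => intro _; rw [hq0, infDist_zero_of_mem hy]; simp
    | succ i ih =>
      intro hi
      have h1 := ih (by omega)
      have hiN : i ≤ N := by omega
      obtain ⟨p, hp, hqp⟩ := hnear i hiN
      have hgi : infDist (q i) E ≤ N * τ * l := by linarith [hG i, hAge i, hNi i hiN]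
      have hyq := hB i
      have hAi := hAge i
      have hNi' := hNi i hiN
      have hqz1 := dist_triangle y (q i) z
      have hqz2 := dist_triangle (q i) y z
      rw [dist_comm (q i) y] at hqz2
      have h2 := H.infDist_pt_sq_le (x := x) (z := z) hE hμ1 hδ hδ8 hopp hl (by linarith) (by linarith) hlδ hp hqp
        (hAhalf i hiN) (hAle i) (by linarith) (by linarith) (by linarith) (by linarith) j
      rw [← hqs] at h2
      have h3 : dist (q i) x / 2 ^ j ≤ τ * l := by
        rw [hτdef, one_div_mul_eq_div]
        gcongr
        exact hAle i
      have h4 : (dist (q i) x / 2 ^ j) ^ 2 ≤ (τ * l) ^ 2 := by gcongr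
      have h5 : 4 * μ * (infDist (q i) E * (dist (q i) x / 2 ^ j)) ≤
          4 * μ * (N * τ * l * (τ * l)) := by gcongr
      push_cast
      linarith
  obtain ⟨y', hy', hgy'⟩ := hnear N le_rfl
  have hgN := hGsq N le_rfl
  have hTN := hT N le_rfl
  have hAN := hAge N
  have hBN := hB N
  set g := infDist (q N) E
  set T := l - dist (q N) x with hTdef
  have hNτl : 0 < N * τ * l := by positivity
  have hgT : g ≤ ε / 4 * T := by
    refine abs_le_of_sq_le_sq' ?_ (by have : 0 ≤ T := by linarith
                                      positivity) |>.2
    have h1 : (N * τ * l / 2) ^ 2 ≤ T ^ 2 := pow_le_pow_left₀ (by positivity) (by linarith) 2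
    have h2 : (1 + 4 * μ * N) * 64 ≤ N * ε ^ 2 := by
      rw [hμdef]
      linarith
    have h3 : N * (τ * l) ^ 2 * ((1 + 4 * μ * N) * 64) ≤ N * (τ * l) ^ 2 * (N * ε ^ 2) := by gcongr
    have h4 : ε ^ 2 * (N * τ * l / 2) ^ 2 ≤ ε ^ 2 * T ^ 2 := by gcongr
    linarith
  have hT0 : 0 < T := by linarith
  have h1 : dist y y' ≤ T + g := by
    rw [hgy']
    exact (dist_triangle y (q N) y').trans (by linarith)
  have h2 : dist x y' ≤ l - T + g := by
    rw [hgy']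
    refine (dist_triangle x (q N) y').trans ?_
    rw [dist_comm x]
    linarith
  have hεT : ε * T ≤ 1 * T := by gcongr
  have hNR : N * τ * l ≤ N * τ * R := by gcongr
  refine ⟨y', hy', by linarith, ?_, by linarith⟩
  have h3 : T - ε / 4 * T ≤ l - dist x y' := by linarith
  have h4 : (1 + ε) * (T - ε / 4 * T) ≤ (1 + ε) * (l - dist x y') := by gcongr
  nlinarith

/-- Discrete paths inside `E` with jumps at most `σ`, joining `y` to `x`. -/
theorem exists_chain {X : Type*} [MetricSpace X] {E : Set X} {x : X} (hx : x ∈ E)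
    {ε σ θ R : ℝ} (hε : 0 ≤ ε) (hθ : θ < 1)
    (hstep : ∀ y ∈ E, y ≠ x → dist x y < R → ∃ y' ∈ E,
      dist y y' ≤ σ ∧ dist y y' ≤ (1 + ε) * (dist x y - dist x y') ∧
      dist x y' ≤ (1 - θ) * dist x y) (hθ0 : 0 < θ) (k : ℕ) :
    ∀ y ∈ E, dist x y < R → (1 - θ) ^ k * dist x y ≤ σ →
      ∃ f : ℝ → X, (∀ t, f t ∈ E ∩ closedBall x (dist x y)) ∧ f 0 = y ∧
        (∀ t, (1 + ε) * dist x y ≤ t → f t = x) ∧ (∀ t, 0 ≤ t → dist y (f t) ≤ t) ∧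
        ∀ s t, 0 ≤ s → s ≤ t → dist (f s) (f t) ≤ t - s + σ := by
  induction k with
  | zero =>
    intro y hy hyR hyσ
    rw [pow_zero, one_mul] at hyσ
    have hd : 0 ≤ dist x y := dist_nonneg
    refine ⟨fun t => if t < dist x y then y else x, fun t => ?_, ?_, fun t ht => ?_,
      fun t ht => ?_, fun s t hs hst => ?_⟩
    · dsimp only
      split_ifs
      · exact ⟨hy, by rw [mem_closedBall']⟩
      · exact ⟨hx, mem_closedBall_self hd⟩
    · dsimp only
      split_ifs with h
      · rfl
      · exact dist_le_zero.1 (not_lt.1 h)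
    · exact if_neg (by nlinarith)
    · dsimp only
      split_ifs with h
      · rwa [dist_self]
      · rw [dist_comm]
        linarith
    · dsimp only
      split_ifs <;> (try rw [dist_self]) <;> linarith [dist_comm y x]
  | succ k ih =>
    intro y hy hyR hyσ
    by_cases hyx : y = x
    · refine ih y hy hyR ?_
      rw [hyx, dist_self, mul_zero] at hyσ ⊢
      exact hyσ
    obtain ⟨y', hy', h1, h2, h3⟩ := hstep y hy hyx hyR
    have hd : 0 ≤ θ * dist x y := by positivity
    have hle : dist x y' ≤ dist x y := by linarith
    obtain ⟨f, f1, f2, f3, f4, f5⟩ := ih y' hy' (hle.trans_lt hyR) (by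
      refine le_trans ?_ hyσ
      rw [pow_succ, mul_assoc]
      have : 0 ≤ 1 - θ := by linarith
      gcongr)
    have hdy : 0 ≤ dist y y' := dist_nonneg
    refine ⟨fun t => if t < dist y y' then y else f (t - dist y y'), fun t => ?_, ?_, fun t ht => ?_,
      fun t ht => ?_, fun s t hs hst => ?_⟩
    · dsimp only
      split_ifs
      · exact ⟨hy, by rw [mem_closedBall']⟩
      · exact ⟨(f1 _).1, closedBall_subset_closedBall hle (f1 _).2⟩
    · dsimp only
      split_ifs with h
      · rfl
      · have h0 : dist y y' = 0 := le_antisymm (not_lt.1 h) hdy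
        rw [h0, sub_zero, f2, dist_eq_zero.1 h0]
    · have h5 : (1 + ε) * dist x y' ≤ t - dist y y' := by linarith
      have h6 : 0 ≤ (1 + ε) * dist x y' := by positivity
      exact (if_neg (by linarith)).trans (f3 _ h5)
    · dsimp only
      split_ifs with h
      · rwa [dist_self]
      · linarith [dist_triangle y y' (f (t - dist y y')), f4 (t - dist y y') (by linarith)]
    · dsimp only
      by_cases hs' : s < dist y y'
      · rw [if_pos hs']
        split_ifs with ht
        · rw [dist_self]
          linarith
        · linarith [dist_triangle y y' (f (t - dist y y')), f4 (t - dist y y') (by linarith)]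
      · rw [if_neg hs', if_neg (by linarith)]
        linarith [f5 (s - dist y y') (t - dist y y') (by linarith) (by linarith)]

/-- Discrete paths with smaller and smaller jumps converge to a Lipschitz curve. -/
theorem exists_curve {X : Type*} [MetricSpace X] {K : Set X} (hK : IsCompact K) {x y : X} {L : ℝ}
    (h : ∀ σ > 0, ∃ f : ℝ → X, (∀ t, f t ∈ K) ∧ f 0 = y ∧ f L = x ∧
      ∀ s t, 0 ≤ s → s ≤ t → dist (f s) (f t) ≤ t - s + σ) :
    ∃ γ : ℝ → X, (∀ t, γ t ∈ K) ∧ γ 0 = y ∧ γ L = x ∧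
      ∀ s t, 0 ≤ s → s ≤ t → dist (γ s) (γ t) ≤ t - s := by
  set σ : ℕ → ℝ := fun k => 1 / ((k : ℝ) + 1) with hσ
  have hσ0 : ∀ k, 0 < σ k := fun k => by positivity
  choose f f1 f2 f3 f4 using fun k => h (σ k) (hσ0 k)
  have hlim : ∀ t, ∃ p ∈ K, Filter.Tendsto (fun k => f k t)
      (Filter.hyperfilter ℕ : Filter ℕ) (nhds p) := fun t =>
    hK.ultrafilter_le_nhds ((Filter.hyperfilter ℕ).map fun k => f k t)
      (Filter.tendsto_principal.2 (Filter.Eventually.of_forall fun k => f1 k t))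
  choose γ hγ1 hγ2 using hlim
  have hconst : ∀ t p, (∀ k, f k t = p) → γ t = p := fun t p hp =>
    tendsto_nhds_unique (hγ2 t) (by simp only [hp]; exact tendsto_const_nhds)
  refine ⟨γ, hγ1, hconst 0 y f2, hconst L x f3,
    fun s t hs hst => ?_⟩
  have hσt : Filter.Tendsto (fun k => t - s + σ k) (Filter.hyperfilter ℕ : Filter ℕ)
      (nhds (t - s + 0)) :=
    tendsto_const_nhds.add (tendsto_one_div_add_atTop_nhds_zero_nat.mono_left
      Nat.hyperfilter_le_atTop)
  rw [add_zero] at hσt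
  exact le_of_tendsto_of_tendsto' ((hγ2 s).dist (hγ2 t)) hσt fun k => f4 k s t hs hst

theorem intrinsicEDist_le_of_curve {X : Type*} [MetricSpace X] {E : Set X} {x y : X} {L : ℝ}
    (hL : 0 ≤ L) {γ : ℝ → X} (hγE : ∀ t, γ t ∈ E) (h0 : γ 0 = y) (h1 : γ L = x)
    (hγ : ∀ s t, 0 ≤ s → s ≤ t → dist (γ s) (γ t) ≤ t - s) :
    intrinsicEDist E y x ≤ ENNReal.ofReal L := by
  have hlip : LipschitzOnWith L.toNNReal (fun t => γ (L * t)) (Icc 0 1) := by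
    refine LipschitzOnWith.of_dist_le_mul fun s hs t ht => ?_
    rw [Real.coe_toNNReal L hL, Real.dist_eq]
    wlog hst : s ≤ t generalizing s t
    · rw [dist_comm, abs_sub_comm]
      exact this t ht s hs (not_le.1 hst).le
    rw [abs_sub_comm, abs_of_nonneg (sub_nonneg.2 hst), mul_sub]
    exact hγ _ _ (mul_nonneg hL hs.1) (by gcongr)
  have hvar : eVariationOn (fun t => γ (L * t)) (Icc 0 1) ≤ ENNReal.ofReal L := by
    have h2 := hlip.comp_eVariationOn_le (g := id) (mapsTo_id (Icc (0 : ℝ) 1))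
    have h3 := (monotone_id.monotoneOn (Icc (0 : ℝ) 1)).eVariationOn_eq
      (left_mem_Icc.2 zero_le_one) (right_mem_Icc.2 zero_le_one)
    rw [inter_self] at h3
    refine h2.trans ?_
    rw [h3]
    simp [ENNReal.ofReal]
  exact (iInf_le_of_le (fun t => γ (L * t)) (iInf_le_of_le hlip.continuousOn (iInf_le_of_le
    (by simpa using h0) (iInf_le_of_le (by simpa using h1) (iInf_le_of_le
      (fun t _ => hγE _) hvar)))))

theorem HingeSpace.exists_intrinsicEDist_le {X : Type*} [MetricSpace X] [CompleteSpace X] {C r : ℝ}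
    {pt : X → X → ℕ → X} (H : HingeSpace X C r pt) {n : ℕ} (hn : dimH (univ : Set X) = n)
    {E : Set X} (hE : NearestCritical C r E) (hEc : IsClosed E) {x : X} (hx : x ∈ E) {ε : ℝ}
    (hε : 0 < ε) (hε1 : ε ≤ 1) :
    ∃ R > 0, ∀ y ∈ E, dist x y < R →
      intrinsicEDist E y x ≤ ENNReal.ofReal ((1 + ε) * dist x y) := by
  obtain ⟨R, hR, hstep⟩ := H.exists_step hn hE hEc x hε hε1
  have hr := H.r_pos
  refine ⟨min R (r / 4), lt_min hR (by positivity), fun y hy hyR => ?_⟩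
  have hL : 0 ≤ (1 + ε) * dist x y := by positivity
  obtain ⟨γ, g1, g2, g3, g4⟩ := exists_curve (K := E ∩ closedBall x (r / 4)) (x := x) (y := y)
    ((H.isCompact_closedBall hn x).inter_left hEc) fun σ hσ => by
      obtain ⟨θ, hθ0, hθ1, hs⟩ := hstep σ hσ
      obtain ⟨k, hk⟩ := exists_pow_lt_of_lt_one (x := σ / (dist x y + 1)) (y := 1 - θ)
        (by positivity) (by linarith)
      have hk' : (1 - θ) ^ k * dist x y ≤ σ := by
        rw [lt_div_iff₀ (by positivity)] at hk
        have : 0 ≤ (1 - θ) ^ k := pow_nonneg (by linarith) k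
        linarith
      obtain ⟨f, f1, f2, f3, -, f5⟩ := exists_chain hx hε.le hθ1 hs hθ0 k y hy
        (hyR.trans_le (min_le_left _ _)) hk'
      exact ⟨f, fun t => ⟨(f1 t).1, closedBall_subset_closedBall
        (hyR.trans_le (min_le_right _ _)).le (f1 t).2⟩, f2, f3 _ le_rfl, f5⟩
  exact intrinsicEDist_le_of_curve hL (fun t => (g1 t).1) g2 g3 g4

theorem edist_le_intrinsicEDist {X : Type*} [MetricSpace X] (E : Set X) (x y : X) :
    edist x y ≤ intrinsicEDist E x y := by
  refine le_iInf fun γ => le_iInf fun _ => le_iInf fun h0 => le_iInf fun h1 => le_iInf fun _ => ?_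
  rw [← h0, ← h1]
  exact eVariationOn.edist_le γ (left_mem_Icc.2 zero_le_one) (right_mem_Icc.2 zero_le_one)

theorem intrinsicEDist_le {X : Type*} [MetricSpace X] {E : Set X} {γ : ℝ → X}
    (hc : ContinuousOn γ (Icc 0 1)) (hE : ∀ t ∈ Icc (0 : ℝ) 1, γ t ∈ E) :
    intrinsicEDist E (γ 0) (γ 1) ≤ eVariationOn γ (Icc 0 1) :=
  iInf_le_of_le γ (iInf_le_of_le hc (iInf_le_of_le rfl (iInf_le_of_le rfl (iInf_le _ hE))))

theorem intrinsicEDist_self {X : Type*} [MetricSpace X] {E : Set X} {x : X} (hx : x ∈ E) :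
    intrinsicEDist E x x = 0 := by
  have h := intrinsicEDist_le (γ := fun _ => x) continuousOn_const fun _ _ => hx
  have h0 : eVariationOn (fun _ : ℝ => x) (Icc 0 1) = 0 :=
    eVariationOn.constant_on ((subsingleton_singleton (a := x)).anti (by simp))
  exact le_antisymm (h.trans_eq h0) zero_le

theorem intrinsicEDist_comm {X : Type*} [MetricSpace X] (E : Set X) (x y : X) :
    intrinsicEDist E x y = intrinsicEDist E y x := by
  suffices h : ∀ x y : X, intrinsicEDist E x y ≤ intrinsicEDist E y x from
    le_antisymm (h x y) (h y x)
  intro x y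
  refine le_iInf fun γ => le_iInf fun hc => le_iInf fun h0 => le_iInf fun h1 => le_iInf fun hE => ?_
  have hmaps : MapsTo (fun t : ℝ => 1 - t) (Icc 0 1) (Icc 0 1) := fun t ht =>
    ⟨by linarith [ht.2], by linarith [ht.1]⟩
  have h := intrinsicEDist_le (E := E) (γ := γ ∘ fun t => 1 - t)
    (hc.comp (by fun_prop) hmaps) fun t ht => hE _ (hmaps ht)
  simp only [Function.comp_apply, sub_zero, sub_self, h0, h1] at h
  exact h.trans (eVariationOn.comp_le_of_antitoneOn γ _
    (fun s _ t _ hst => by linarith) hmaps)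

theorem intrinsicEDist_triangle {X : Type*} [MetricSpace X] (E : Set X) (x y z : X) :
    intrinsicEDist E x z ≤ intrinsicEDist E x y + intrinsicEDist E y z := by
  have key : ∀ γ₁ γ₂ : ℝ → X, ContinuousOn γ₁ (Icc 0 1) → ContinuousOn γ₂ (Icc 0 1) →
      γ₁ 0 = x → γ₁ 1 = y → γ₂ 0 = y → γ₂ 1 = z → (∀ t ∈ Icc (0 : ℝ) 1, γ₁ t ∈ E) →
      (∀ t ∈ Icc (0 : ℝ) 1, γ₂ t ∈ E) →
      intrinsicEDist E x z ≤ eVariationOn γ₁ (Icc 0 1) + eVariationOn γ₂ (Icc 0 1) := by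
    intro γ₁ γ₂ c₁ c₂ h₁0 h₁1 h₂0 h₂1 e₁ e₂
    let γ : ℝ → X := fun t => if t ≤ 1 / 2 then γ₁ (2 * t) else γ₂ (2 * t - 1)
    have m₁ : MapsTo (fun t : ℝ => 2 * t) (Icc 0 (1 / 2)) (Icc 0 1) := fun t ht =>
      ⟨by linarith [ht.1], by linarith [ht.2]⟩
    have m₂ : MapsTo (fun t : ℝ => 2 * t - 1) (Icc (1 / 2) 1) (Icc 0 1) := fun t ht =>
      ⟨by linarith [ht.1], by linarith [ht.2]⟩
    have q₁ : EqOn γ (γ₁ ∘ fun t => 2 * t) (Icc 0 (1 / 2)) := fun t ht => if_pos ht.2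
    have q₂ : EqOn γ (γ₂ ∘ fun t => 2 * t - 1) (Icc (1 / 2) 1) := fun t ht => by
      rcases eq_or_lt_of_le ht.1 with rfl | hlt
      · norm_num [γ, h₁1, h₂0]
      · exact if_neg (not_le.2 hlt)
    have hunion : Icc (0 : ℝ) (1 / 2) ∪ Icc (1 / 2) 1 = Icc 0 1 :=
      Icc_union_Icc_eq_Icc (by norm_num) (by norm_num)
    have hc : ContinuousOn γ (Icc 0 1) := by
      rw [← hunion]
      exact ((c₁.comp (by fun_prop) m₁).congr q₁).union_of_isClosed
        ((c₂.comp (by fun_prop) m₂).congr q₂) isClosed_Icc isClosed_Icc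
    have hE : ∀ t ∈ Icc (0 : ℝ) 1, γ t ∈ E := fun t ht => by
      rcases hunion.symm ▸ ht with ht | ht
      · rw [q₁ ht]
        exact e₁ _ (m₁ ht)
      · rw [q₂ ht]
        exact e₂ _ (m₂ ht)
    have hvar : eVariationOn γ (Icc 0 1) ≤
        eVariationOn γ₁ (Icc 0 1) + eVariationOn γ₂ (Icc 0 1) := by
      have h := eVariationOn.Icc_add_Icc γ (s := univ) (a := (0 : ℝ)) (b := 1 / 2) (c := 1)
        (by norm_num) (by norm_num) (mem_univ _)
      simp only [univ_inter] at h
      rw [← h, eVariationOn.congr q₁, eVariationOn.congr q₂]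
      gcongr
      · exact eVariationOn.comp_le_of_monotoneOn γ₁ _ (fun s _ t _ hst => by linarith) m₁
      · exact eVariationOn.comp_le_of_monotoneOn γ₂ _ (fun s _ t _ hst => by linarith) m₂
    have h0 : γ 0 = x := by rw [q₁ (by norm_num)]; simpa using h₁0
    have h1 : γ 1 = z := by rw [q₂ (by norm_num)]; norm_num [h₂1]
    rw [← h0, ← h1]
    exact (intrinsicEDist_le hc hE).trans hvar
  generalize intrinsicEDist E x z = I at key ⊢
  simp only [intrinsicEDist, ENNReal.iInf_add, ENNReal.add_iInf, le_iInf_iff]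
  intros
  apply key <;> assumption

/-- The set `E` equipped with its intrinsic metric. -/
def IntrinsicSpace {X : Type*} (E : Set X) : Type _ := E

noncomputable instance {X : Type*} [MetricSpace X] (E : Set X) :
    EMetricSpace (IntrinsicSpace E) where
  edist x y := intrinsicEDist E x.1 y.1
  edist_self x := intrinsicEDist_self x.2
  edist_comm x y := intrinsicEDist_comm E x.1 y.1
  edist_triangle x y z := intrinsicEDist_triangle E x.1 y.1 z.1
  eq_of_edist_eq_zero {x y} h := Subtype.ext (edist_eq_zero.1
    (le_antisymm ((edist_le_intrinsicEDist E x.1 y.1).trans_eq h) zero_le))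

noncomputable instance {X : Type*} [MetricSpace X] (E : Set X) : MeasurableSpace (IntrinsicSpace E) := borel _

instance {X : Type*} [MetricSpace X] (E : Set X) : BorelSpace (IntrinsicSpace E) := ⟨rfl⟩

theorem hMeas_mono {X : Type*} {ρ ρ' : X → X → ℝ≥0∞} (h : ∀ x y, ρ x y ≤ ρ' x y) {m : ℝ}
    (hm : 0 ≤ m) (S : Set X) : hMeas ρ m S ≤ hMeas ρ' m S := by
  have hd : ∀ s : Set X, ediamOn ρ s ≤ ediamOn ρ' s := fun s =>
    iSup₂_mono fun x _ => iSup₂_mono fun y _ => h x y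
  refine iSup₂_mono fun ε _ => le_iInf fun t => le_iInf fun ht => le_iInf fun hε => ?_
  refine iInf_le_of_le t (iInf_le_of_le ht (iInf_le_of_le (fun k => (hd _).trans (hε k)) ?_))
  exact ENNReal.tsum_le_tsum fun k => ENNReal.rpow_le_rpow (hd _) hm

theorem hMeas_zero {X : Type*} (ρ : X → X → ℝ≥0∞) (S : Set X) : hMeas ρ 0 S = ⊤ := by
  refine top_unique (le_iSup₂_of_le 1 one_pos ?_)
  refine le_iInf fun t => le_iInf fun _ => le_iInf fun _ => ?_
  simp

theorem hMeas_intrinsicEDist_le {X : Type*} [MetricSpace X] (E : Set X) {m : ℝ} (hm : 0 < m) :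
    hMeas (intrinsicEDist E) m E ≤
      MeasureTheory.Measure.hausdorffMeasure m (univ : Set (IntrinsicSpace E)) := by
  rw [MeasureTheory.Measure.hausdorffMeasure_apply]
  refine iSup₂_mono fun ε _ => le_iInf fun t => le_iInf fun ht => le_iInf fun hε => ?_
  let t' : ℕ → Set X := fun k => Subtype.val '' (t k : Set E)
  have hd : ∀ k, ediamOn (intrinsicEDist E) (t' k) = ediam (t k) := fun k => by
    refine le_antisymm (iSup₂_le fun x hx => iSup₂_le fun y hy => ?_)
      (ediam_le fun x hx y hy => ?_)
    · obtain ⟨x, hx, rfl⟩ := hx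
      obtain ⟨y, hy, rfl⟩ := hy
      exact edist_le_ediam_of_mem (s := t k) hx hy
    · exact le_iSup₂_of_le x.1 ⟨x, hx, rfl⟩ (le_iSup₂_of_le y.1 ⟨y, hy, rfl⟩ le_rfl)
  refine iInf_le_of_le t' (iInf_le_of_le (fun x hx => ?_) (iInf_le_of_le
    (fun k => (hd k).trans_le (hε k)) ?_))
  · obtain ⟨k, hk⟩ := mem_iUnion.1 (ht (mem_univ (⟨x, hx⟩ : E)))
    exact mem_iUnion.2 ⟨k, _, hk, rfl⟩
  · refine ENNReal.tsum_le_tsum fun k => ?_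
    rw [hd]
    rcases (t k).eq_empty_or_nonempty with h | h
    · rw [h, ediam_empty, ENNReal.zero_rpow_of_pos hm]
      exact zero_le
    · exact le_iSup_of_le h le_rfl

theorem hausdorffMeasure_le_hMeas {X : Type*} [MetricSpace X] {E : Set X} {m : ℝ} (hm : 0 < m)
    {c η : ℝ≥0∞} (hc0 : c ≠ 0) (hc : c ≠ ⊤) (hη : 0 < η) (S : Set (IntrinsicSpace E))
    (hS : ∀ x ∈ S, ∀ y ∈ S, edist x.1 y.1 < η →
      intrinsicEDist E x.1 y.1 ≤ c * edist x.1 y.1) :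
    MeasureTheory.Measure.hausdorffMeasure m S ≤ c ^ m * hMeas (fun x y => edist x y) m E := by
  rw [MeasureTheory.Measure.hausdorffMeasure_apply]
  refine iSup₂_le fun r hr => ?_
  have hcm0 : c ^ m ≠ 0 := by simp [hc0, hc, ENNReal.rpow_eq_zero_iff]
  have hcm : c ^ m ≠ ⊤ := ENNReal.rpow_ne_top_of_nonneg hm.le hc
  rw [mul_comm, ← ENNReal.div_le_iff hcm0 hcm]
  obtain ⟨η', hη'0, hη'⟩ := exists_between hη
  refine le_iSup₂_of_le (min (r / c) η') (lt_min (ENNReal.div_pos hr.ne' hc) hη'0) ?_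
  refine le_iInf fun t => le_iInf fun ht => le_iInf fun hε => ?_
  rw [ENNReal.div_le_iff hcm0 hcm, mul_comm, ← ENNReal.tsum_mul_left]
  let t' : ℕ → Set (IntrinsicSpace E) := fun k => {x | x ∈ S ∧ x.1 ∈ t k}
  have hd : ∀ k, ediam (t' k) ≤ c * ediamOn (fun x y => edist x y) (t k) := fun k => by
    refine ediam_le fun x hx y hy => ?_
    have h : edist x.1 y.1 ≤ ediamOn (fun x y => edist x y) (t k) :=
      le_iSup₂_of_le x.1 hx.2 (le_iSup₂_of_le y.1 hy.2 le_rfl)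
    refine (hS x hx.1 y hy.1 (((h.trans (hε k)).trans (min_le_right _ _)).trans_lt hη')).trans ?_
    gcongr
  refine iInf_le_of_le t' (iInf_le_of_le (fun x hx => ?_) (iInf_le_of_le (fun k => ?_) ?_))
  · obtain ⟨k, hk⟩ := mem_iUnion.1 (ht x.2)
    exact mem_iUnion.2 ⟨k, hx, hk⟩
  · refine (hd k).trans ?_
    calc c * ediamOn (fun x y => edist x y) (t k) ≤ c * (r / c) := by
          gcongr
          exact (hε k).trans (min_le_left _ _)
      _ = r := ENNReal.mul_div_cancel hc0 hc
  · refine ENNReal.tsum_le_tsum fun k => iSup_le fun _ => ?_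
    rw [← ENNReal.mul_rpow_of_nonneg _ _ hm.le]
    exact ENNReal.rpow_le_rpow (hd k) hm.le

/-- If the intrinsic metric is infinitesimally at most `c` times the extrinsic one, then the
Hausdorff measures are related accordingly. -/
theorem hMeas_intrinsicEDist_le_mul {X : Type*} [MetricSpace X] {E : Set X} {m : ℝ} (hm : 0 < m)
    {c : ℝ≥0∞} (hc0 : c ≠ 0) (hc : c ≠ ⊤)
    (h : ∀ x ∈ E, ∃ R > (0 : ℝ), ∀ y ∈ E, dist x y < R → intrinsicEDist E x y ≤ c * edist x y) :
    hMeas (intrinsicEDist E) m E ≤ c ^ m * hMeas (fun x y => edist x y) m E := by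
  refine (hMeas_intrinsicEDist_le E hm).trans ?_
  let S : ℕ → Set (IntrinsicSpace E) := fun k => {x | ∀ y ∈ E,
    edist x.1 y < ENNReal.ofReal (1 / ((k : ℝ) + 1)) → intrinsicEDist E x.1 y ≤ c * edist x.1 y}
  have hmono : Monotone S := fun j k hjk x hx y hy hxy => hx y hy (hxy.trans_le (by gcongr))
  have hunion : ⋃ k, S k = univ := by
    refine eq_univ_of_forall fun x => ?_
    obtain ⟨R, hR, hx⟩ := h x.1 x.2
    obtain ⟨k, hk⟩ := exists_nat_one_div_lt hR
    refine mem_iUnion.2 ⟨k, fun y hy hxy => hx y hy (lt_trans ?_ hk)⟩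
    rwa [edist_dist, ENNReal.ofReal_lt_ofReal_iff (by positivity)] at hxy
  rw [← hunion, hmono.measure_iUnion]
  refine iSup_le fun k => hausdorffMeasure_le_hMeas hm hc0 hc
    (η := ENNReal.ofReal (1 / ((k : ℝ) + 1))) (ENNReal.ofReal_pos.2 (by positivity)) (S k)
    fun x hx y _ hxy => hx y.1 y.2 hxy

theorem IsExtremal.hMeas_intrinsicEDist_le {X : Type*} [MetricSpace X] {κ : ℝ}
    (hX : IsAlexandrov X κ) {n : ℕ} (hdim : dimH (univ : Set X) = n) {E : Set X}
    (hE : IsExtremal κ E) {m : ℝ} (hm : 0 < m) {ε : ℝ} (hε : 0 < ε) (hε1 : ε ≤ 1) :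
    hMeas (intrinsicEDist E) m E ≤
      ENNReal.ofReal (1 + ε) ^ m * hMeas (fun x y => edist x y) m E := by
  have := hX.1
  obtain ⟨r, pt, H, hr⟩ := exists_hingeSpace hX
  refine hMeas_intrinsicEDist_le_mul hm (ENNReal.ofReal_pos.2 (by linarith)).ne'
    ENNReal.ofReal_ne_top fun x hx => ?_
  obtain ⟨R, hR, h⟩ := H.exists_intrinsicEDist_le hdim (hE.nearestCritical hr) hE.1 hx hε hε1
  refine ⟨R, hR, fun y hy hxy => ?_⟩
  rw [intrinsicEDist_comm, edist_dist, ← ENNReal.ofReal_mul (by linarith)]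
  exact h y hy hxy

/-- the `m`-dimensional Hausdorff measures of an `m`-dimensional
extremal subset with respect to the intrinsic and extrinsic metrics coincide. -/
theorem stmt8 {X : Type*} [MetricSpace X] (κ : ℝ) (hX : IsAlexandrov X κ)
    (n : ℕ) (hdim : dimH (Set.univ : Set X) = n)
    (E : Set X) (hE : IsExtremal κ E) (m : ℕ) (hEdim : dimH E = m) :
    hMeas (fun x y => edist x y) (m : ℝ) E = hMeas (intrinsicEDist E) (m : ℝ) E := by
  rcases m.eq_zero_or_pos with rfl | hm
  · rw [Nat.cast_zero, hMeas_zero, hMeas_zero]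
  have hm' : (0 : ℝ) < m := by exact_mod_cast hm
  refine le_antisymm (hMeas_mono (edist_le_intrinsicEDist E) hm'.le E) ?_
  have hlim : Filter.Tendsto
      (fun ε : ℝ => ENNReal.ofReal (1 + ε) ^ (m : ℝ) * hMeas (fun x y => edist x y) (m : ℝ) E)
      (nhdsWithin 0 (Ioi 0)) (nhds (1 * hMeas (fun x y => edist x y) (m : ℝ) E)) := by
    refine ENNReal.Tendsto.mul_const ?_ (Or.inl one_ne_zero)
    have h : Continuous fun ε : ℝ => ENNReal.ofReal (1 + ε) ^ (m : ℝ) :=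
      ENNReal.continuous_rpow_const.comp (ENNReal.continuous_ofReal.comp (by fun_prop))
    simpa using (h.tendsto 0).mono_left nhdsWithin_le_nhds
  rw [one_mul] at hlim
  refine ge_of_tendsto hlim ?_
  filter_upwards [Ioo_mem_nhdsGT one_pos] with ε hε
  exact hE.hMeas_intrinsicEDist_le hX hdim hm' hε.1 hε.2.le
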